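/- arXiv:1902.01063 — 2 statements merged into one kernel-verified Lean document; each statement's English description precedes it below -/
import Mathlib

section
/- For every p > 1, λ₁ = ( (2/π) ∫₀^1 ((p−1)/(1 − X^p))^{1/p} dX )², i.e. the optimal Poincaré constant λ₁ is given by this explicit integral formula. -/
open MeasureTheory Real

/-- The L^r norm on the circle with the uniform probability measure dσ = dx/(2π),
for a 2π-periodic function `u : ℝ → ℝ`. -/
noncomputable def perNorm (r : ℝ) (u : ℝ → ℝ) : ℝ :=
  ((1 / (2 * π)) * ∫ x in (0:ℝ)..(2 * π), |u x| ^ r) ^ (1 / r)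

/-- `u` is 2π-periodic and C¹. -/
def PeriodicC1 (u : ℝ → ℝ) : Prop :=
  Function.Periodic u (2 * π) ∧ ContDiff ℝ 1 u

/-- λ₁ = inf ‖v'‖_p²/‖v‖_p² over 2π-periodic C¹ functions v ≢ 0 with ∫₀^{2π} v dx = 0. -/
noncomputable def lambdaOne (p : ℝ) : ℝ :=
  sInf { l : ℝ | ∃ v : ℝ → ℝ, PeriodicC1 v ∧ v ≠ 0 ∧
    (∫ x in (0:ℝ)..(2 * π), v x) = 0 ∧
    l = (perNorm p (deriv v)) ^ 2 / (perNorm p v) ^ 2 }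

/-- λ₁* = inf ‖v'‖_p²/‖v‖_2² over 2π-periodic C¹ functions v ≢ 0 with ∫₀^{2π} v dx = 0. -/
noncomputable def lambdaOneStar (p : ℝ) : ℝ :=
  sInf { l : ℝ | ∃ v : ℝ → ℝ, PeriodicC1 v ∧ v ≠ 0 ∧
    (∫ x in (0:ℝ)..(2 * π), v x) = 0 ∧
    l = (perNorm p (deriv v)) ^ 2 / (perNorm 2 v) ^ 2 }

/-- The p-Laplacian L_p u = (|u'|^{p-2} u')'. -/
noncomputable def pLap (p : ℝ) (u : ℝ → ℝ) : ℝ → ℝ :=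
  deriv (fun x => |deriv u x| ^ (p - 2) * deriv u x)


lemma sinh_mul_le {q : ℝ} (hq : 1 ≤ q) {y : ℝ} (hy : 0 ≤ y) :
    sinh (q*y) * cosh y ≤ q * (sinh y * cosh (q*y)) := by
  have hd : ∀ x : ℝ, HasDerivAt (fun y => q * (sinh y * cosh (q*y)) - sinh (q*y) * cosh y)
      ((q^2-1) * (sinh x * sinh (q*x))) x := by
    intro x
    have h1 : HasDerivAt (fun y => q*y) q x := by simpa using (hasDerivAt_id x).const_mul q
    have := (((Real.hasDerivAt_sinh x).mul h1.cosh).const_mul q).sub (h1.sinh.mul (Real.hasDerivAt_cosh x))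
    refine this.congr_deriv ?_
    ring
  have := monotoneOn_of_deriv_nonneg (convex_Ici (0:ℝ)) (f := (fun y => q * (sinh y * cosh (q*y)) - sinh (q*y) * cosh y))
    (fun x _ => (hd x).continuousAt.continuousWithinAt) (fun x _ => (hd x).differentiableAt.differentiableWithinAt)
    (by
      intro x hx
      rw [interior_Ici, Set.mem_Ioi] at hx
      rw [(hd x).deriv]
      have : 0 ≤ sinh x := Real.sinh_nonneg_iff.2 hx.le
      have : 0 ≤ sinh (q*x) := Real.sinh_nonneg_iff.2 (by positivity)
      have : 0 ≤ q^2-1 := by nlinarith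
      positivity)
  have := this (Set.mem_Ici.2 le_rfl) (Set.mem_Ici.2 hy) hy
  simp at this
  linarith

lemma ell_hasDeriv (q x : ℝ) : HasDerivAt (fun y => Real.log (cosh (q*y)) - (q+2) * Real.log (cosh y))
    (q * (sinh (q*x) / cosh (q*x)) - (q+2) * (sinh x / cosh x)) x := by
  have h1 : HasDerivAt (fun y => q*y) q x := by simpa using (hasDerivAt_id x).const_mul q
  have := (h1.cosh.log (Real.cosh_pos _).ne').sub (((Real.hasDerivAt_cosh x).log (Real.cosh_pos _).ne').const_mul (q+2))
  refine this.congr_deriv ?_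
  ring

lemma ell_nonpos {q : ℝ} (hq0 : 0 ≤ q) (hq : q ≤ 1) {y : ℝ} (hy : 0 ≤ y) :
    Real.log (cosh (q*y)) - (q+2) * Real.log (cosh y) ≤ 0 := by
  have h1 : cosh (q*y) ≤ cosh y := by
    rw [Real.cosh_le_cosh, abs_of_nonneg (by positivity), abs_of_nonneg hy]; nlinarith
  have h2 := Real.log_le_log (Real.cosh_pos _) h1
  have h3 := Real.log_nonneg (Real.one_le_cosh y)
  nlinarith

lemma ell_bound {q : ℝ} (hq : 1 ≤ q) {y : ℝ} (hy : 0 ≤ y) :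
    (q+2) * (Real.log (cosh (q*y)) - (q+2) * Real.log (cosh y)) ≤
     (q^2-1) * (sinh y * (cosh y * (sinh (q*y)/cosh (q*y)) + sinh y)) := by
  have hd : ∀ x : ℝ, HasDerivAt (fun y => (q^2-1) * (sinh y * (cosh y * (sinh (q*y)/cosh (q*y)) + sinh y)) - (q+2) * (Real.log (cosh (q*y)) - (q+2) * Real.log (cosh y)))
      ((q^2-1) * ( cosh x * (cosh x * (sinh (q*x)/cosh (q*x)) + sinh x) + sinh x * (sinh x * (sinh (q*x)/cosh (q*x)) + cosh x * ((cosh (q*x) * q * cosh (q*x) - sinh (q*x) * (sinh (q*x) * q)) / cosh (q*x)^2)  + cosh x)) - (q+2) * (q * (sinh (q*x) / cosh (q*x)) - (q+2) * (sinh x / cosh x))) x := by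
    intro x
    have h1 : HasDerivAt (fun y => q*y) q x := by simpa using (hasDerivAt_id x).const_mul q
    have := (((Real.hasDerivAt_sinh x).mul (((Real.hasDerivAt_cosh x).mul (h1.sinh.div h1.cosh (Real.cosh_pos _).ne')).add (Real.hasDerivAt_sinh x))).const_mul (q^2-1)).sub ((ell_hasDeriv q x).const_mul (q+2))
    exact this
  have := monotoneOn_of_deriv_nonneg (convex_Ici (0:ℝ)) 
    (fun x _ => (hd x).continuousAt.continuousWithinAt) (fun x _ => (hd x).differentiableAt.differentiableWithinAt)
    (by
      intro x hx
      rw [interior_Ici, Set.mem_Ioi] at hx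
      rw [(hd x).deriv]
      have hs : 0 ≤ sinh x := Real.sinh_nonneg_iff.2 hx.le
      have hS : 0 ≤ sinh (q*x) := Real.sinh_nonneg_iff.2 (by positivity)
      have hc := Real.one_le_cosh x
      have hC := Real.cosh_pos (q*x)
      have hq1 : 0 ≤ q^2-1 := by nlinarith
      have e1 : (cosh (q*x) * q * cosh (q*x) - sinh (q*x) * (sinh (q*x) * q)) / cosh (q*x)^2 = q / cosh (q*x)^2 := by
        congr 1
        have := Real.cosh_sq (q*x)
        linear_combination q * this
      rw [e1]
      have hT : sinh (q*x) / cosh (q*x) ≤ q * (sinh x / cosh x) := by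
        rw [← mul_div_assoc, div_le_div_iff₀ hC (by linarith)]
        have := sinh_mul_le hq hx.le
        linarith
      have hT0 : 0 ≤ sinh (q*x) / cosh (q*x) := by positivity
      set T := sinh (q*x) / cosh (q*x)
      have ht : sinh x / cosh x ≤ cosh x * sinh x := by
        rw [div_le_iff₀ (by linarith)]
        nlinarith [mul_nonneg hs (by nlinarith : 0 ≤ cosh x^2-1)]
      have ht0 : 0 ≤ sinh x / cosh x := by positivity
      set t := sinh x / cosh x
      have hE : 0 ≤ sinh x * (sinh x * T + cosh x * (q / cosh (q*x)^2)) := by positivity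
      have hG : T ≤ cosh x * cosh x * T := by
        have : 1 ≤ cosh x * cosh x := by nlinarith
        nlinarith
      have k1 : (q^2-1) * (T + 2 * t) ≤ (q^2-1) * ( cosh x * (cosh x * T + sinh x) + sinh x * (sinh x * T + cosh x * (q / cosh (q*x)^2)  + cosh x)) := by
        apply mul_le_mul_of_nonneg_left _ hq1
        nlinarith
      have k2 : (2*q+1) * T ≤ (2*q+1) * (q*t) := by gcongr
      have k3 : 0 ≤ t * (q^2 + 3*q+2) := by positivity
      nlinarith)
  have := this (Set.mem_Ici.2 le_rfl) (Set.mem_Ici.2 hy) hy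
  simp at this
  linarith

lemma scalar_y {p : ℝ} (hp : 1 < p) {A B : ℝ} (hA : 0 ≤ A) (hB : 0 ≤ B)
    (hAB : (p-2) * B ≤ (p+1) * A) {y : ℝ} (hy : 0 ≤ y) :
    (cosh ((p-1)*y) / cosh y) * (A + B) ≤ A * cosh (p*y) + B * ((cosh ((p-1)*y) / cosh y)^(1-1/p) * cosh y) := by
  have hc := Real.cosh_pos y
  have hC := Real.cosh_pos ((p-1)*y)
  set c := cosh ((p-1)*y) / cosh y with hcdef
  have hc0 : 0 < c := by positivity
  set ell := Real.log (cosh ((p-1)*y)) - ((p-1)+2) * Real.log (cosh y) with hell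
  have hs : 0 ≤ sinh y := Real.sinh_nonneg_iff.2 hy
  have hS : 0 ≤ sinh ((p-1)*y) := Real.sinh_nonneg_iff.2 (mul_nonneg (by linarith) hy)
  have e1 : c^(1-1/p) * cosh y = c * exp (-ell/p) := by
    have hl : Real.log c = Real.log (cosh ((p-1)*y)) - Real.log (cosh y) := by
      rw [hcdef, Real.log_div hC.ne' hc.ne']
    have h2 : c * exp (-ell/p) = exp (Real.log c + -ell/p) := by rw [exp_add, exp_log hc0]
    have h3 : c^(1-1/p) * cosh y = exp (Real.log c * (1-1/p) + Real.log (cosh y)) := by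
      rw [exp_add, exp_log hc, Real.rpow_def_of_pos hc0]
    rw [h2, h3, hl, hell]
    congr 1
    field_simp
    ring
  rw [e1]
  have e2 : cosh (p*y) = c + sinh y * (cosh y * (sinh ((p-1)*y)/cosh ((p-1)*y)) + sinh y) * c := by
    have : p*y = (p-1)*y + y := by ring
    rw [this, Real.cosh_add, hcdef]
    have := Real.cosh_sq y
    field_simp
    linear_combination (cosh ((p-1)*y)) * this
  rw [e2]
  have e3 : 1 + -ell/p ≤ exp (-ell/p) := by linarith [Real.add_one_le_exp (-ell/p)]
  have hW0 : 0 ≤ sinh y * (cosh y * (sinh ((p-1)*y)/cosh ((p-1)*y)) + sinh y) := by positivity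
  have hW : p ≥ 2 → (p+1) * ell ≤ (p*(p-2)) * (sinh y * (cosh y * (sinh ((p-1)*y)/cosh ((p-1)*y)) + sinh y)) := by
    intro h
    have := ell_bound (q := p-1) (by linarith) hy
    rw [← hell] at this
    ring_nf at this ⊢
    exact this
  set W := sinh y * (cosh y * (sinh ((p-1)*y)/cosh ((p-1)*y)) + sinh y)
  have main : 0 ≤ A * W + B * (-ell/p) := by
    rcases le_total p 2 with h | h
    · have := ell_nonpos (q := p-1) (by linarith) (by linarith) hy
      rw [← hell] at this
      have : 0 ≤ -ell/p := div_nonneg (by linarith) (by linarith)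
      positivity
    · have := hW h
      have h1 : 0 ≤ (A * W + B * (-ell/p)) * (p * (p+1)) := by
        have : (A * W + B * (-ell/p)) * (p * (p+1)) = p * ((p+1) * A) * W - B * ((p+1) * ell) := by
          field_simp
          ring
        rw [this]
        have k1 : p * ((p-2) * B) * W ≤ p * ((p+1) * A) * W := by gcongr
        have k2 := mul_le_mul_of_nonneg_left (hW h) hB
        nlinarith
      exact nonneg_of_mul_nonneg_left h1 (by positivity)
  have k := mul_le_mul_of_nonneg_left e3 (mul_nonneg hB hc0.le)
  have := mul_nonneg hc0.le main
  nlinarith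

lemma scalar_ineq {p : ℝ} (hp : 1 < p) {A B : ℝ} (hA : 0 ≤ A) (hB : 0 ≤ B)
    (hAB : (p-2) * B ≤ (p+1) * A) {M m : ℝ} (hm : 0 < m) (hM : 0 < M) :
    2 * ((M^p*m+m^p*M)/(M+m)) * (A+B) ≤ A * (M^p+m^p) + B * (((M^p*m+m^p*M)/(M+m))^(1-1/p) * (M+m)) := by
  wlog h : m ≤ M generalizing M m
  · have := this hM hm (le_of_not_ge h)
    rw [add_comm m M, add_comm (m^p*M), add_comm (m^p) (M^p)] at this
    exact this
  obtain ⟨a, rfl⟩ : ∃ a, M = exp a := ⟨Real.log M, (exp_log hM).symm⟩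
  obtain ⟨b, rfl⟩ : ∃ b, m = exp b := ⟨Real.log m, (exp_log hm).symm⟩
  have hba : b ≤ a := exp_le_exp.1 h
  set r := (a+b)/2 with hr
  set y := (a-b)/2 with hy
  have hy0 : 0 ≤ y := by rw [hy]; linarith
  have e1 : (exp a)^p = exp (p*r) * exp (p*y) := by
    rw [← exp_mul, ← exp_add]; congr 1; rw [hr, hy]; ring
  have e2 : (exp b)^p = exp (p*r) * exp (-(p*y)) := by
    rw [← exp_mul, ← exp_add]; congr 1; rw [hr, hy]; ring
  have e3 : exp a = exp r * exp y := by
    rw [← exp_add]; congr 1; rw [hr, hy]; ring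
  have e4 : exp b = exp r * exp (-y) := by
    rw [← exp_add]; congr 1; rw [hr, hy]; ring
  have hc := Real.cosh_pos y
  have hC := Real.cosh_pos ((p-1)*y)
  have f1 : exp a ^ p + exp b ^ p = 2 * (exp (p*r) * cosh (p*y)) := by
    rw [e1, e2, Real.cosh_eq]; ring
  have f2 : exp a + exp b = 2 * (exp r * cosh y) := by
    rw [e3, e4, Real.cosh_eq]; ring
  have f3 : (exp a ^ p * exp b + exp b ^ p * exp a) = 2 * (exp (p*r) * exp r * cosh ((p-1)*y)) := by
    rw [e1, e2, e3, e4, Real.cosh_eq]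
    have g1 : exp ((p-1)*y) = exp (p*y) * exp (-y) := by rw [← exp_add]; congr 1; ring
    have g2 : exp (-((p-1)*y)) = exp (-(p*y)) * exp y := by rw [← exp_add]; congr 1; ring
    rw [g1, g2]; ring
  have f4 : (exp a ^ p * exp b + exp b ^ p * exp a) / (exp a + exp b) = exp (p*r) * (cosh ((p-1)*y)/cosh y) := by
    rw [f3, f2]
    have := (exp_pos r).ne'
    field_simp
  rw [f4, f1, f2, Real.mul_rpow (exp_pos _).le (by positivity)]
  have g3 : exp (p*r) ^ (1-1/p) * exp r = exp (p*r) := by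
    rw [← exp_mul, ← exp_add]; congr 1; field_simp; ring
  have := mul_le_mul_of_nonneg_left (scalar_y hp hA hB hAB hy0) (exp_pos (p*r)).le
  calc _ = 2 * (exp (p*r) * ((cosh ((p-1)*y) / cosh y) * (A + B))) := by ring
    _ ≤ 2 * (exp (p*r) * (A * cosh (p*y) + B * ((cosh ((p-1)*y) / cosh y)^(1-1/p) * cosh y))) := by linarith
    _ = 2 * ((exp (p*r)) * A * cosh (p*y)) + 2 * ((exp (p*r)) * (B * ((cosh ((p-1)*y) / cosh y)^(1-1/p) * cosh y))) := by ring
    _ = 2 * ((exp (p*r)) * A * cosh (p*y)) + 2 * ((exp (p*r) ^ (1-1/p) * exp r) * (B * ((cosh ((p-1)*y) / cosh y)^(1-1/p) * cosh y))) := by rw [g3]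
    _ = _ := by ring


lemma one_sub_rpow_pos {p : ℝ} (hp : 1 < p) {x : ℝ} (hx : x ∈ Set.Ioo (0:ℝ) 1) : 0 < 1 - x^p := by
  have := Real.rpow_lt_one hx.1.le hx.2 (by linarith : 0 < p)
  linarith

lemma rpow_le_self_of {p : ℝ} (hp : 1 < p) {x : ℝ} (hx : x ∈ Set.Icc (0:ℝ) 1) : x^p ≤ x := by
  rcases hx.1.eq_or_lt with h | h
  · rw [← h, Real.zero_rpow (by linarith)]
  · simpa using Real.rpow_le_rpow_of_exponent_ge h hx.2 hp.le

lemma cont_rpow {p : ℝ} (hp : 1 < p) : Continuous (fun x : ℝ => x^p) :=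
  Real.continuous_rpow_const (by linarith)

lemma sing_integrable {p : ℝ} (hp : 1 < p) :
    IntervalIntegrable (fun x : ℝ => (1 - x^p)^(-(1/p))) volume 0 1 := by
  have h1 : IntervalIntegrable (fun x : ℝ => (1 - x)^(-(1/p))) volume 0 1 := by
    have : IntervalIntegrable (fun x : ℝ => x^(-(1/p))) volume 0 1 :=
      intervalIntegral.intervalIntegrable_rpow' (by
        have : 1/p < 1 := by rw [div_lt_one] <;> linarith
        linarith)
    have := this.comp_sub_left 1
    simpa using this.symm
  rw [intervalIntegrable_iff_integrableOn_Ioo_of_le zero_le_one] at h1 ⊢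
  refine h1.mono' ?_ ?_
  · exact (((measurable_const.sub (cont_rpow hp).measurable).pow_const _)).aestronglyMeasurable
  · filter_upwards [ae_restrict_mem measurableSet_Ioo] with x hx
    have h := one_sub_rpow_pos hp hx
    rw [Real.norm_of_nonneg (by positivity)]
    apply Real.rpow_le_rpow_of_nonpos (by linarith [hx.2])
    · linarith [rpow_le_self_of hp ⟨hx.1.le, hx.2.le⟩]
    · have : 0 < 1/p := by positivity
      linarith

lemma theta_pos {p : ℝ} (hp : 1 < p) : 0 < 1 - 1/p := by
  have : 1/p < 1 := by rw [div_lt_one] <;> linarith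
  linarith

lemma cont_J {p : ℝ} (hp : 1 < p) : Continuous (fun x : ℝ => (1 - x^p)^(1-1/p)) :=
  (Real.continuous_rpow_const (theta_pos hp).le).comp (continuous_const.sub (cont_rpow hp))

lemma J_I {p : ℝ} (hp : 1 < p) :
    p * (∫ x in (0:ℝ)..1, (1 - x^p)^(1-1/p)) = (p-1) * ∫ x in (0:ℝ)..1, (1 - x^p)^(-(1/p)) := by
  have hi1 : IntervalIntegrable (fun x : ℝ => p * (1 - x^p)^(1-1/p)) volume 0 1 :=
    ((cont_J hp).intervalIntegrable 0 1).const_mul p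
  have hi2 := (sing_integrable hp).const_mul (p-1)
  have key := intervalIntegral.integral_eq_sub_of_hasDerivAt_of_le (zero_le_one)
    (f := fun x : ℝ => x * (1 - x^p)^(1-1/p))
    (f' := fun x : ℝ => p * (1 - x^p)^(1-1/p) - (p-1) * (1 - x^p)^(-(1/p)))
    (continuous_id.mul (cont_J hp)).continuousOn ?_ (hi1.sub hi2)
  · rw [intervalIntegral.integral_sub hi1 hi2, intervalIntegral.integral_const_mul, intervalIntegral.integral_const_mul] at key
    simp at key
    have h0 : (0:ℝ)^(1-p⁻¹) = 0 := Real.zero_rpow (by simpa using (theta_pos hp).ne')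
    rw [h0] at key
    simp
    linarith
  · intro x hx
    have h := one_sub_rpow_pos hp hx
    have d1 : HasDerivAt (fun x : ℝ => 1 - x^p) (-(p * x^(p-1))) x :=
      (Real.hasDerivAt_rpow_const (Or.inl hx.1.ne')).const_sub 1
    have d2 := (hasDerivAt_id x).mul (d1.rpow_const (p := 1-1/p) (Or.inl h.ne'))
    refine d2.congr_deriv ?_
    have e1 : (1 - x^p)^(1-1/p) = (1 - x^p) * (1-x^p)^(-(1/p)) := by
      rw [sub_eq_add_neg 1 (1/p), Real.rpow_add h, Real.rpow_one]
    have e2 : x^p = x * x^(p-1) := by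
      have := Real.rpow_add hx.1 1 (p-1)
      simpa using this
    have e3 : (1:ℝ) - 1/p - 1 = -(1/p) := by ring
    rw [e3, e1]
    have hp0 : p ≠ 0 := by linarith
    simp only [id]
    generalize (1 - x^p)^(-(1/p)) = z
    rw [e2]
    field_simp
    ring

noncomputable def AA (p : ℝ) : ℝ := ∫ x in (0:ℝ)..1, (x - x^p) * (1 - x^p)^(-(1/p))
noncomputable def BB (p : ℝ) : ℝ := ∫ x in (0:ℝ)..1, (1 - x) * (1 - x^p)^(-(1/p))
noncomputable def JJ (p : ℝ) : ℝ := ∫ x in (0:ℝ)..1, (1 - x^p)^(1-1/p)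
noncomputable def II (p : ℝ) : ℝ := ∫ x in (0:ℝ)..1, (1 - x^p)^(-(1/p))

lemma intA {p : ℝ} (hp : 1 < p) : IntervalIntegrable (fun x : ℝ => (x - x^p) * (1 - x^p)^(-(1/p))) volume 0 1 :=
  (sing_integrable hp).continuousOn_mul (continuous_id.sub (cont_rpow hp)).continuousOn
lemma intB {p : ℝ} (hp : 1 < p) : IntervalIntegrable (fun x : ℝ => (1 - x) * (1 - x^p)^(-(1/p))) volume 0 1 :=
  (sing_integrable hp).continuousOn_mul (continuous_const.sub continuous_id).continuousOn

lemma AA_nonneg {p : ℝ} (hp : 1 < p) : 0 ≤ AA p := by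
  apply intervalIntegral.integral_nonneg zero_le_one
  intro x hx
  have := rpow_le_self_of hp hx
  apply mul_nonneg (by linarith)
  apply Real.rpow_nonneg; linarith [hx.2]

lemma BB_nonneg {p : ℝ} (hp : 1 < p) : 0 ≤ BB p := by
  apply intervalIntegral.integral_nonneg zero_le_one
  intro x hx
  have := rpow_le_self_of hp hx
  apply mul_nonneg (by linarith [hx.2])
  apply Real.rpow_nonneg; linarith [hx.2]

lemma AB_J {p : ℝ} (hp : 1 < p) : AA p + BB p = JJ p := by
  unfold AA BB JJ
  rw [← intervalIntegral.integral_add (intA hp) (intB hp)]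
  rw [intervalIntegral.integral_of_le zero_le_one, intervalIntegral.integral_of_le zero_le_one,
    integral_Ioc_eq_integral_Ioo, integral_Ioc_eq_integral_Ioo]
  apply setIntegral_congr_fun measurableSet_Ioo
  intro x hx
  have h := one_sub_rpow_pos hp hx
  have e1 : (1 - x^p)^(1-1/p) = (1 - x^p) * (1-x^p)^(-(1/p)) := by
    rw [sub_eq_add_neg 1 (1/p), Real.rpow_add h, Real.rpow_one]
  simp only []
  rw [e1]; ring

lemma JJ_lower {p : ℝ} (hp : 1 < p) : p/(p+1) ≤ JJ p := by
  have : ∫ x in (0:ℝ)..1, (1 - x^p) = p/(p+1) := by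
    rw [intervalIntegral.integral_sub (by simp) ((cont_rpow hp).intervalIntegrable _ _), integral_rpow (Or.inl (by linarith))]
    rw [Real.zero_rpow (by linarith)]
    have : p+1 ≠ 0 := by linarith
    simp
    field_simp
    ring
  rw [← this]
  apply intervalIntegral.integral_mono_on zero_le_one ((continuous_const.sub (cont_rpow hp)).intervalIntegrable _ _) ((cont_J hp).intervalIntegrable _ _)
  intro x hx
  show 1 - x^p ≤ (1-x^p)^(1-1/p)
  have h := rpow_le_self_of hp hx
  have h0 : 0 ≤ x^p := Real.rpow_nonneg hx.1 _
  rcases (by linarith [hx.2] : 0 ≤ 1-x^p).eq_or_lt with h1 | h1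
  · rw [← h1, Real.zero_rpow (theta_pos hp).ne']
  · have : 0 < 1/p := by positivity
    simpa using Real.rpow_le_rpow_of_exponent_ge h1 (by linarith) (by linarith : 1-1/p ≤ 1)

lemma BB_upper {p : ℝ} (hp : 1 < p) : BB p ≤ p/(2*p-1) := by
  have e : ∫ x in (0:ℝ)..1, (1 - x)^(1-1/p) = p/(2*p-1) := by
    rw [intervalIntegral.integral_comp_sub_left (fun x => x^(1-1/p)) 1, integral_rpow (Or.inl (by linarith [theta_pos hp]))]
    have := theta_pos hp
    have h2 : 2*p-1 ≠ 0 := by linarith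
    simp
    rw [Real.zero_rpow (by simp at this; linarith)]
    have h3 : (1 - p⁻¹ + 1) = (2*p-1)/p := by field_simp; ring
    rw [h3]
    simp
  rw [← e]
  unfold BB
  rw [intervalIntegral.integral_of_le zero_le_one, intervalIntegral.integral_of_le zero_le_one,
    integral_Ioc_eq_integral_Ioo, integral_Ioc_eq_integral_Ioo]
  apply setIntegral_mono_on
  · exact (intervalIntegrable_iff_integrableOn_Ioo_of_le zero_le_one).1 (intB hp)
  · exact (intervalIntegrable_iff_integrableOn_Ioo_of_le zero_le_one).1 (((Real.continuous_rpow_const (theta_pos hp).le).comp (continuous_const.sub continuous_id)).intervalIntegrable _ _)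
  · exact measurableSet_Ioo
  intro x hx
  have h := one_sub_rpow_pos hp hx
  have h' := rpow_le_self_of hp ⟨hx.1.le, hx.2.le⟩
  have h1 : 0 < 1 - x := by linarith [hx.2]
  have e1 : (1 - x)^(1-1/p) = (1 - x) * (1-x)^(-(1/p)) := by
    rw [sub_eq_add_neg 1 (1/p), Real.rpow_add h1, Real.rpow_one]
  rw [e1]
  apply mul_le_mul_of_nonneg_left _ h1.le
  apply Real.rpow_le_rpow_of_nonpos h1 (by linarith)
  have : 0 < 1/p := by positivity
  linarith

lemma AB_ratio {p : ℝ} (hp : 1 < p) : (p-2) * BB p ≤ (p+1) * AA p := by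
  have h1 := JJ_lower hp
  have h2 := BB_upper hp
  have h3 := AB_J hp
  rw [div_le_iff₀ (by linarith)] at h1
  rw [le_div_iff₀ (by linarith)] at h2
  nlinarith

lemma half_int {p : ℝ} (hp : 1 < p) {M C : ℝ} (hM : 0 < M) (hC : 0 < C) :
    M^(p-1) * AA p + C^(1-1/p) * BB p ≤ ∫ x in (0:ℝ)..1, (M^p * (x - x^p) + C * (1-x))^(1-1/p) := by
  unfold AA BB
  rw [← intervalIntegral.integral_const_mul, ← intervalIntegral.integral_const_mul,
    ← intervalIntegral.integral_add ((intA hp).const_mul _) ((intB hp).const_mul _)]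
  rw [intervalIntegral.integral_of_le zero_le_one, intervalIntegral.integral_of_le zero_le_one,
    integral_Ioc_eq_integral_Ioo, integral_Ioc_eq_integral_Ioo]
  have hcr := cont_rpow hp
  apply setIntegral_mono_on
  · exact (intervalIntegrable_iff_integrableOn_Ioo_of_le zero_le_one).1 (((intA hp).const_mul _).add ((intB hp).const_mul _))
  · exact (intervalIntegrable_iff_integrableOn_Ioo_of_le zero_le_one).1 (((Real.continuous_rpow_const (theta_pos hp).le).comp (by fun_prop : Continuous fun x : ℝ => M^p * (x - x^p) + C * (1-x))).intervalIntegrable _ _)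
  · exact measurableSet_Ioo
  intro x hx
  have h := one_sub_rpow_pos hp hx
  have h' := rpow_le_self_of hp ⟨hx.1.le, hx.2.le⟩
  have h1 : 0 < 1 - x := by linarith [hx.2]
  have hMp : 0 < M^p := Real.rpow_pos_of_pos hM p
  have hth : 1 - 1/p ≤ 1 := by
    have : 0 < 1/p := by positivity
    linarith
  have conc := (Real.concaveOn_rpow (theta_pos hp).le hth).2 (Set.mem_Ici.2 hMp.le) (Set.mem_Ici.2 hC.le)
    (div_nonneg (by linarith : 0 ≤ x - x^p) h.le) (div_nonneg h1.le h.le)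
    (by field_simp; ring)
  simp only [smul_eq_mul] at conc
  have e1 : (1 - x^p)^(1-1/p) = (1 - x^p) * (1-x^p)^(-(1/p)) := by
    rw [sub_eq_add_neg 1 (1/p), Real.rpow_add h, Real.rpow_one]
  have e2 : (M^p)^(1-1/p) = M^(p-1) := by
    rw [← Real.rpow_mul hM.le]; congr 1; field_simp
  have e3 : M^p * (x - x^p) + C * (1-x) = (1 - x^p) * ((x - x^p)/(1-x^p) * M^p + (1-x)/(1-x^p) * C) := by
    field_simp
  have hpos : 0 ≤ (x - x^p)/(1-x^p) * M^p + (1-x)/(1-x^p) * C :=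
    add_nonneg (mul_nonneg (div_nonneg (by linarith) h.le) hMp.le) (mul_nonneg (div_nonneg h1.le h.le) hC.le)
  rw [e3, Real.mul_rpow h.le hpos]
  refine le_trans (le_of_eq ?_) (mul_le_mul_of_nonneg_left conc (by positivity))
  rw [e1, e2]
  field_simp

lemma half_scaled {p : ℝ} (hp : 1 < p) {M C k : ℝ} (hM : 0 < M) (hC : 0 < C) (hk : C + k * M = M^p) :
    M^p * AA p + M * (C^(1-1/p) * BB p) ≤ ∫ s in (0:ℝ)..M, (C + k * s - |s|^p)^(1-1/p) := by
  have h := half_int hp hM hC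
  have e : ∫ s in (0:ℝ)..M, (C + k * s - |s|^p)^(1-1/p) =
      M * ∫ x in (0:ℝ)..1, (M^p * (x - x^p) + C * (1-x))^(1-1/p) := by
    have := intervalIntegral.mul_integral_comp_mul_left (a := 0) (b := 1) (f := fun s : ℝ => (C + k * s - |s|^p)^(1-1/p)) M
    rw [mul_zero, mul_one] at this
    rw [← this]
    congr 1
    apply intervalIntegral.integral_congr
    intro x hx
    rw [Set.uIcc_of_le zero_le_one] at hx
    simp only []
    congr 1
    rw [abs_of_nonneg (mul_nonneg hM.le hx.1), Real.mul_rpow hM.le hx.1]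
    linear_combination x * hk
  rw [e]
  have e2 : M^p = M * M^(p-1) := by
    have := Real.rpow_add hM 1 (p-1)
    simpa using this
  have h' := mul_le_mul_of_nonneg_left h hM.le
  have e3 : M^p * AA p = M * M^(p-1) * AA p := by rw [← e2]
  rw [e3]
  linarith

lemma h_nonneg {p : ℝ} (hp : 1 < p) {M C k : ℝ} (hM : 0 < M) (hC : 0 < C) (hk : C + k * M = M^p)
    {s : ℝ} (h0 : 0 ≤ s) (hs : s ≤ M) : 0 ≤ C + k * s - |s|^p := by
  obtain ⟨x, rfl⟩ : ∃ x, s = M * x := ⟨s/M, by field_simp⟩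
  have hx0 : 0 ≤ x := nonneg_of_mul_nonneg_right h0 hM
  have hx1 : x ≤ 1 := by
    by_contra hh; push Not at hh; nlinarith
  have hx := rpow_le_self_of hp ⟨hx0, hx1⟩
  rw [abs_of_nonneg h0, Real.mul_rpow hM.le hx0]
  have hMp : 0 < M^p := Real.rpow_pos_of_pos hM p
  have : C + k * (M*x) - M^p * x^p = M^p * (x - x^p) + C * (1-x) := by linear_combination x * hk
  rw [this]
  have := mul_nonneg hMp.le (by linarith : 0 ≤ x - x^p)
  have := mul_nonneg hC.le (by linarith : 0 ≤ 1 - x)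
  linarith

lemma phi_lower {p : ℝ} (hp : 1 < p) {M m : ℝ} (hm : 0 < m) (hM : 0 < M) :
    ∃ C k : ℝ, 0 < C ∧ (∀ s ∈ Set.Icc (-m) M, 0 ≤ C + k * s - |s|^p) ∧
      2 * C * JJ p ≤ ∫ s in (-m)..M, (C + k * s - |s|^p)^(1-1/p) := by
  have hMp : 0 < M^p := Real.rpow_pos_of_pos hM p
  have hmp : 0 < m^p := Real.rpow_pos_of_pos hm p
  set C := (M^p*m+m^p*M)/(M+m) with hCd
  set k := (M^p - m^p)/(M+m) with hkd
  have hC : 0 < C := by positivity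
  have hk1 : C + k * M = M^p := by rw [hCd, hkd]; field_simp; ring
  have hk2 : C + (-k) * m = m^p := by rw [hCd, hkd]; field_simp; ring
  have hcont : Continuous fun s : ℝ => (C + k * s - |s|^p)^(1-1/p) := by
    have h1 : Continuous fun s : ℝ => |s|^p := (cont_rpow hp).comp continuous_abs
    exact (Real.continuous_rpow_const (theta_pos hp).le).comp (by fun_prop)
  refine ⟨C, k, hC, ?_, ?_⟩
  · intro s hs
    rcases le_total 0 s with h | h
    · exact h_nonneg hp hM hC hk1 h hs.2
    · have := h_nonneg hp hm hC hk2 (s := -s) (by linarith) (by linarith [hs.1])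
      rw [abs_neg] at this
      linarith
  · rw [← intervalIntegral.integral_add_adjacent_intervals (hcont.intervalIntegrable _ 0) (hcont.intervalIntegrable _ _)]
    have i1 := half_scaled hp hM hC hk1
    have i2 := half_scaled hp hm hC hk2
    have e : ∫ s in (-m)..0, (C + k * s - |s|^p)^(1-1/p) = ∫ s in (0:ℝ)..m, (C + (-k) * s - |s|^p)^(1-1/p) := by
      have := intervalIntegral.integral_comp_neg (a := 0) (b := m) (fun s : ℝ => (C + k * s - |s|^p)^(1-1/p))
      rw [neg_zero] at this
      rw [← this]
      apply intervalIntegral.integral_congr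
      intro x _
      simp
    rw [e]
    have := scalar_ineq hp (AA_nonneg hp) (BB_nonneg hp) (AB_ratio hp) hm hM
    rw [← hCd, AB_J hp] at this
    nlinarith

lemma young_pt {p : ℝ} (hp : 1 < p) {a b : ℝ} (ha : 0 ≤ a) (hb : 0 ≤ b) :
    p * (a * b^(1-1/p)) - (p-1) * b ≤ a^p := by
  have hq : p.HolderConjugate (Real.conjExponent p) := Real.HolderConjugate.conjExponent hp
  have := Real.young_inequality_of_nonneg ha (Real.rpow_nonneg hb (1-1/p)) hq
  have hp1 : p - 1 ≠ 0 := by linarith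
  have e : (b^(1-1/p))^(Real.conjExponent p) = b := by
    rw [← Real.rpow_mul hb]
    have : (1-1/p) * Real.conjExponent p = 1 := by
      unfold Real.conjExponent; field_simp
    rw [this, Real.rpow_one]
  rw [e] at this
  have e2 : b / Real.conjExponent p = (p-1) * b / p := by
    unfold Real.conjExponent; field_simp
  rw [e2, ← add_div, le_div_iff₀ (by linarith)] at this
  linarith

lemma updown {v g : ℝ → ℝ} (hv : PeriodicC1 v) (hg : Continuous g) (hg0 : ∀ s, 0 ≤ g s)
    {x0 x1 : ℝ} (h1 : x0 ≤ x1) (h2 : x1 ≤ x0 + 2 * π) :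
    2 * (∫ s in (v x0)..(v x1), g s) ≤ ∫ x in (0:ℝ)..(2*π), |deriv v x| * g (v x) := by
  obtain ⟨hper, hc1⟩ := hv
  have hd : ∀ x, HasDerivAt v (deriv v x) x := fun x =>
    (hc1.differentiable (by norm_num) x).hasDerivAt
  have hdc : Continuous (deriv v) := hc1.continuous_deriv (by norm_num)
  have hvc : Continuous v := hc1.continuous
  have hdper : Function.Periodic (deriv v) (2*π) := by
    intro x
    have := deriv_comp_add_const v (2*π) x
    rw [← this]
    congr 1
    funext y
    exact hper y
  have hper2 : Function.Periodic (fun x => |deriv v x| * g (v x)) (2*π) := by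
    intro x
    simp only [hdper x, hper x]
  have e0 := hper2.intervalIntegral_add_eq 0 x0
  rw [zero_add] at e0
  rw [e0]
  have hci : Continuous (fun x => |deriv v x| * g (v x)) := by fun_prop
  have hcj : Continuous (fun x => deriv v x * g (v x)) := by fun_prop
  rw [← intervalIntegral.integral_add_adjacent_intervals (hci.intervalIntegrable x0 x1) (hci.intervalIntegrable x1 _)]
  have s1 : ∀ a b : ℝ, ∫ x in a..b, deriv v x * g (v x) = ∫ s in (v a)..(v b), g s := by
    intro a b
    have := intervalIntegral.integral_comp_mul_deriv (a := a) (b := b) (fun x _ => hd x) hdc.continuousOn hg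
    rw [← this]
    apply intervalIntegral.integral_congr
    intro x _
    simp [mul_comm]
  have k1 : ∫ s in (v x0)..(v x1), g s ≤ ∫ x in x0..x1, |deriv v x| * g (v x) := by
    rw [← s1]
    apply intervalIntegral.integral_mono_on h1 (hcj.intervalIntegrable _ _) (hci.intervalIntegrable _ _)
    intro x _
    exact mul_le_mul_of_nonneg_right (le_abs_self _) (hg0 _)
  have k2 : ∫ s in (v x0)..(v x1), g s ≤ ∫ x in x1..(x0 + 2*π), |deriv v x| * g (v x) := by
    have : ∫ s in (v x0)..(v x1), g s = ∫ x in x1..(x0 + 2*π), -(deriv v x * g (v x)) := by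
      rw [intervalIntegral.integral_neg, s1, hper x0, ← intervalIntegral.integral_symm]
    rw [this]
    apply intervalIntegral.integral_mono_on h2 (hcj.neg.intervalIntegrable _ _) (hci.intervalIntegrable _ _)
    intro x _
    show -(deriv v x * g (v x)) ≤ _
    rw [← neg_mul]
    exact mul_le_mul_of_nonneg_right (neg_le_abs _) (hg0 _)
  linarith

lemma II_pos {p : ℝ} (hp : 1 < p) : 0 < II p := by
  have h1 : p * JJ p = (p-1) * II p := J_I hp
  have h2 := JJ_lower hp
  have h3 : 0 < p/(p+1) := by positivity
  have h4 : 0 < p * JJ p := mul_pos (by linarith) (by linarith)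
  rw [h1] at h4
  exact pos_of_mul_pos_right h4 (by linarith)

noncomputable def KK (p : ℝ) : ℝ := (2 * II p / π)^p

lemma KK_pos {p : ℝ} (hp : 1 < p) : 0 < KK p := by
  have := II_pos hp
  unfold KK; positivity

lemma KK_rel {p : ℝ} (hp : 1 < p) : 2 * p * JJ p * (KK p)^(1-1/p) = π * ((p-1) * KK p) := by
  have h1 : p * JJ p = (p-1) * II p := J_I hp
  have hI := II_pos hp
  have hb : 0 < 2 * II p / π := by positivity
  have e1 : (KK p)^(1-1/p) = (2 * II p / π)^(p-1) := by
    unfold KK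
    rw [← Real.rpow_mul hb.le]; congr 1; field_simp
  have e2 : KK p = (2 * II p / π) * (2 * II p / π)^(p-1) := by
    unfold KK
    have := Real.rpow_add hb 1 (p-1)
    simpa using this
  rw [e1, e2]
  have : 2 * p * JJ p = 2 * ((p-1) * II p) := by rw [← h1]; ring
  rw [this]
  field_simp

lemma lower_bound {p : ℝ} (hp : 1 < p) {v : ℝ → ℝ} (hv : PeriodicC1 v) (hne : v ≠ 0)
    (hmean : ∫ x in (0:ℝ)..(2*π), v x = 0) :
    (0 < ∫ x in (0:ℝ)..(2*π), |v x|^p) ∧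
    ((p-1) * KK p) * (∫ x in (0:ℝ)..(2*π), |v x|^p) ≤ ∫ x in (0:ℝ)..(2*π), |deriv v x|^p := by
  have hper := hv.1
  have hc1 := hv.2
  have hvc : Continuous v := hc1.continuous
  have hdc : Continuous (deriv v) := hc1.continuous_deriv (by norm_num)
  have hpi : (0:ℝ) < 2 * π := by positivity
  have hcp : Continuous fun x => |v x|^p := (cont_rpow hp).comp hvc.abs
  have hcdp : Continuous fun x => |deriv v x|^p := (cont_rpow hp).comp hdc.abs
  obtain ⟨y0, hy0⟩ : ∃ y, v y ≠ 0 := by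
    by_contra hh; push Not at hh; exact hne (funext hh)
  obtain ⟨z, hz, hzy⟩ := hper.exists_mem_Ico₀ hpi y0
  have hvz : v z ≠ 0 := by rw [← hzy]; exact hy0
  obtain ⟨x0, hx0, hmin⟩ := (isCompact_Icc (a := (0:ℝ)) (b := 2*π)).exists_isMinOn ⟨0, by simp [hpi.le]⟩ hvc.continuousOn
  obtain ⟨x1, hx1, hmax⟩ := (isCompact_Icc (a := (0:ℝ)) (b := 2*π)).exists_isMaxOn ⟨0, by simp [hpi.le]⟩ hvc.continuousOn
  have hmin' : ∀ x ∈ Set.Icc 0 (2*π), v x0 ≤ v x := fun x hx => hmin hx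
  have hmax' : ∀ x ∈ Set.Icc 0 (2*π), v x ≤ v x1 := fun x hx => hmax hx
  have hzI : z ∈ Set.Icc 0 (2*π) := ⟨hz.1, hz.2.le⟩
  have hM : 0 < v x1 := by
    by_contra hh; push Not at hh
    have : 0 < ∫ x in (0:ℝ)..(2*π), - v x := by
      apply intervalIntegral.integral_pos hpi hvc.neg.continuousOn
      · intro x hx; have := hmax' x ⟨hx.1.le, hx.2⟩; simp; linarith
      · exact ⟨z, hzI, by have := lt_of_le_of_ne ((hmax' z hzI).trans hh) hvz; simpa using this⟩
    rw [intervalIntegral.integral_neg, hmean] at this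
    simp at this
  have hm : v x0 < 0 := by
    by_contra hh; push Not at hh
    have : 0 < ∫ x in (0:ℝ)..(2*π), v x := by
      apply intervalIntegral.integral_pos hpi hvc.continuousOn
      · intro x hx; have := hmin' x ⟨hx.1.le, hx.2⟩; linarith
      · exact ⟨z, hzI, lt_of_le_of_ne (hh.trans (hmin' z hzI)) hvz.symm⟩
    rw [hmean] at this
    simp at this
  refine ⟨?_, ?_⟩
  · apply intervalIntegral.integral_pos hpi hcp.continuousOn
    · intro x _; positivity
    · exact ⟨z, hzI, by positivity⟩
  obtain ⟨C, k, hC, hh, hphi⟩ := phi_lower hp (m := -v x0) (by linarith) hM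
  rw [neg_neg] at hh hphi
  obtain ⟨x2, h1, h2, h3⟩ : ∃ x2, x0 ≤ x2 ∧ x2 ≤ x0 + 2*π ∧ v x2 = v x1 := by
    rcases le_total x0 x1 with h | h
    · exact ⟨x1, h, by linarith [hx1.2, hx0.1], rfl⟩
    · exact ⟨x1 + 2*π, by linarith [hx1.1, hx0.2], by linarith, hper x1⟩
  set g : ℝ → ℝ := fun s => (max (C + k * s - |s|^p) 0)^(1-1/p) with hg
  have hcont0 : Continuous fun s : ℝ => C + k * s - |s|^p := by
    have h1 : Continuous fun s : ℝ => |s|^p := (cont_rpow hp).comp continuous_abs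
    fun_prop
  have hgc : Continuous g :=
    (Real.continuous_rpow_const (theta_pos hp).le).comp (hcont0.max continuous_const)
  have hg0 : ∀ s, 0 ≤ g s := fun s => Real.rpow_nonneg (le_max_right _ _) _
  have ud := updown hv hgc hg0 h1 h2
  rw [h3] at ud
  have eg : ∫ s in (v x0)..(v x1), g s = ∫ s in (v x0)..(v x1), (C + k * s - |s|^p)^(1-1/p) := by
    apply intervalIntegral.integral_congr
    intro s hs
    rw [Set.uIcc_of_le (by linarith)] at hs
    simp only [hg]
    rw [max_eq_left (hh s hs)]
  rw [eg] at ud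
  have hK := KK_pos hp
  set K := KK p
  have i1 : IntervalIntegrable (fun x => p * K^(1-1/p) * (|deriv v x| * g (v x))) volume 0 (2*π) := by
    have : Continuous (fun x => p * K^(1-1/p) * (|deriv v x| * g (v x))) := by fun_prop
    exact this.intervalIntegrable _ _
  have i2 : IntervalIntegrable (fun x => (p-1) * K * (C + k * v x - |v x|^p)) volume 0 (2*π) := by
    have : Continuous (fun x => (p-1) * K * (C + k * v x - |v x|^p)) := by fun_prop
    exact this.intervalIntegrable _ _
  have main : ∫ x in (0:ℝ)..(2*π), (p * K^(1-1/p) * (|deriv v x| * g (v x)) - (p-1) * K * (C + k * v x - |v x|^p)) ≤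
      ∫ x in (0:ℝ)..(2*π), |deriv v x|^p := by
    apply intervalIntegral.integral_mono_on hpi.le (i1.sub i2) (hcdp.intervalIntegrable _ _)
    intro x hx
    have hr := hh (v x) ⟨hmin' x hx, hmax' x hx⟩
    have := young_pt hp (abs_nonneg (deriv v x)) (mul_nonneg hK.le hr)
    rw [Real.mul_rpow hK.le hr] at this
    simp only [hg]
    rw [max_eq_left hr]
    linarith
  rw [intervalIntegral.integral_sub i1 i2, intervalIntegral.integral_const_mul, intervalIntegral.integral_const_mul] at main
  have e3 : ∫ x in (0:ℝ)..(2*π), (C + k * v x - |v x|^p) = 2 * π * C - ∫ x in (0:ℝ)..(2*π), |v x|^p := by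
    rw [intervalIntegral.integral_sub ((by fun_prop : Continuous fun x => C + k * v x).intervalIntegrable _ _) (hcp.intervalIntegrable _ _),
      intervalIntegral.integral_add (by simp) ((by fun_prop : Continuous fun x => k * v x).intervalIntegrable _ _),
      intervalIntegral.integral_const_mul, hmean]
    simp
  rw [e3] at main
  have rel := KK_rel hp
  have hKt : 0 ≤ p * K^(1-1/p) := by positivity
  have f1 := mul_le_mul_of_nonneg_left (show 2 * (2 * C * JJ p) ≤ ∫ x in (0:ℝ)..(2*π), |deriv v x| * g (v x) by linarith) hKt
  have f2 : p * K^(1-1/p) * (2 * (2 * C * JJ p)) = 2 * C * (π * ((p-1) * K)) := by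
    rw [← rel]; ring
  nlinarith

noncomputable def fF (p X : ℝ) : ℝ := 1 + Set.indicator (Set.Ioo (0:ℝ) 1) (fun x => (1 - x^p)^(-(1/p)) - 1) X

lemma fF_eq (p : ℝ) {x : ℝ} (hx : x ∈ Set.Ioo (0:ℝ) 1) : fF p x = (1 - x^p)^(-(1/p)) := by
  unfold fF; rw [Set.indicator_of_mem hx]; ring

lemma fF_int {p : ℝ} (hp : 1 < p) (a b : ℝ) : IntervalIntegrable (fF p) volume a b := by
  have h : Integrable (Set.indicator (Set.Ioo (0:ℝ) 1) (fun x => (1 - x^p)^(-(1/p)) - 1)) := by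
    rw [integrable_indicator_iff measurableSet_Ioo]
    exact (intervalIntegrable_iff_integrableOn_Ioo_of_le zero_le_one).1 ((sing_integrable hp).sub (by simp))
  exact (intervalIntegrable_const (c := (1:ℝ))).add h.intervalIntegrable

lemma fF_ge {p : ℝ} (hp : 1 < p) (x : ℝ) : 1 ≤ fF p x := by
  unfold fF
  have : 0 ≤ Set.indicator (Set.Ioo (0:ℝ) 1) (fun x => (1 - x^p)^(-(1/p)) - 1) x := by
    apply Set.indicator_nonneg
    intro x hx
    have h := one_sub_rpow_pos hp hx
    have h0 : 0 ≤ x^p := Real.rpow_nonneg hx.1.le _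
    have := Real.one_le_rpow_of_pos_of_le_one_of_nonpos h (by linarith) (z := -(1/p)) (by
      have : 0 < 1/p := by positivity
      linarith)
    linarith
  linarith

noncomputable def FF (p s : ℝ) : ℝ := ∫ x in (0:ℝ)..s, fF p x

lemma FF_sub {p : ℝ} (hp : 1 < p) {a b : ℝ} (hab : a ≤ b) : b - a ≤ FF p b - FF p a := by
  unfold FF
  rw [intervalIntegral.integral_interval_sub_left (fF_int hp _ _) (fF_int hp _ _)]
  have := intervalIntegral.integral_mono_on (μ := volume) hab (intervalIntegrable_const (c := (1:ℝ))) (fF_int hp a b) (fun x _ => fF_ge hp x)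
  simpa using this

lemma FF_strictMono {p : ℝ} (hp : 1 < p) : StrictMono (FF p) := by
  intro a b hab
  have := FF_sub hp hab.le
  linarith

lemma FF_zero (p : ℝ) : FF p 0 = 0 := by simp [FF]

lemma FF_one (p : ℝ) : FF p 1 = II p := by
  unfold FF II
  rw [intervalIntegral.integral_of_le zero_le_one, intervalIntegral.integral_of_le zero_le_one,
    integral_Ioc_eq_integral_Ioo, integral_Ioc_eq_integral_Ioo]
  exact setIntegral_congr_fun measurableSet_Ioo (fun x hx => fF_eq p hx)

lemma FF_cont {p : ℝ} (hp : 1 < p) : Continuous (FF p) :=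
  intervalIntegral.continuous_primitive (fF_int hp) 0

lemma FF_surj {p : ℝ} (hp : 1 < p) : Function.Surjective (FF p) := by
  apply (FF_cont hp).surjective
  · apply Filter.tendsto_atTop_mono' _ _ Filter.tendsto_id
    filter_upwards [Filter.eventually_ge_atTop 0] with x hx
    have := FF_sub hp hx
    rw [FF_zero] at this
    simp; linarith
  · apply Filter.tendsto_atBot_mono' _ _ Filter.tendsto_id
    filter_upwards [Filter.eventually_le_atBot 0] with x hx
    have := FF_sub hp hx
    rw [FF_zero] at this
    simp; linarith

lemma FF_deriv {p : ℝ} (hp : 1 < p) {s : ℝ} (hs : s ∈ Set.Ioo (0:ℝ) 1) :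
    HasDerivAt (FF p) ((1 - s^p)^(-(1/p))) s := by
  have hev : fF p =ᶠ[nhds s] fun x => (1 - x^p)^(-(1/p)) := by
    filter_upwards [isOpen_Ioo.mem_nhds hs] with x hx using fF_eq p hx
  have hc : ContinuousAt (fF p) s := by
    apply ContinuousAt.congr _ hev.symm
    exact (continuous_const.sub (cont_rpow hp)).continuousAt.rpow_const (Or.inl (one_sub_rpow_pos hp hs).ne')
  rw [← fF_eq p hs]
  apply intervalIntegral.integral_hasDerivAt_right (fF_int hp _ _) _ hc
  have hm : Measurable (fF p) := by
    unfold fF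
    apply measurable_const.add
    apply Measurable.indicator _ measurableSet_Ioo
    exact ((measurable_const.sub (cont_rpow hp).measurable).pow_const _).sub measurable_const
  exact hm.stronglyMeasurable.stronglyMeasurableAtFilter

lemma exists_S {p : ℝ} (hp : 1 < p) : ∃ S : ℝ → ℝ, Continuous S ∧ StrictMono S ∧ S 0 = 0 ∧ S (II p) = 1 ∧
    ∀ z ∈ Set.Ioo 0 (II p), HasDerivAt S ((1 - (S z)^p)^(1/p)) z := by
  let e := (FF_strictMono hp).orderIsoOfSurjective _ (FF_surj hp)
  have he : ∀ x, e x = FF p x := fun x => rfl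
  have h0 : e.symm 0 = 0 := by rw [OrderIso.symm_apply_eq, he, FF_zero]
  have h1 : e.symm (II p) = 1 := by rw [OrderIso.symm_apply_eq, he, FF_one]
  refine ⟨e.symm, e.symm.continuous, e.symm.strictMono, h0, h1, ?_⟩
  intro z hz
  have hz0 : 0 < e.symm z := by rw [← h0]; exact e.symm.strictMono hz.1
  have hz1 : e.symm z < 1 := by rw [← h1]; exact e.symm.strictMono hz.2
  have hpos := one_sub_rpow_pos hp ⟨hz0, hz1⟩
  have := HasDerivAt.of_local_left_inverse (f := FF p) (g := e.symm) (a := z) e.symm.continuous.continuousAt (FF_deriv hp ⟨hz0, hz1⟩)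
    (by positivity) (Filter.Eventually.of_forall (fun y => by rw [← he]; simp))
  rw [Real.rpow_neg hpos.le, inv_inv] at this
  exact this

lemma quarter {f : ℝ → ℝ} (hf : Continuous f) (h1 : ∀ x, f (x + π) = f x) (h2 : ∀ x, f (π - x) = f x) :
    ∫ x in (0:ℝ)..(2*π), f x = 4 * ∫ x in (0:ℝ)..(π/2), f x := by
  have hi : ∀ a b : ℝ, IntervalIntegrable f volume a b := fun a b => hf.intervalIntegrable a b
  have e1 : ∫ x in π..(2*π), f x = ∫ x in (0:ℝ)..π, f x := by
    have := intervalIntegral.integral_comp_add_right (a := 0) (b := π) f π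
    simp only [h1] at this
    rw [this]; congr 1 <;> ring
  have e2 : ∫ x in (π/2)..π, f x = ∫ x in (0:ℝ)..(π/2), f x := by
    have := intervalIntegral.integral_comp_sub_left (a := 0) (b := π/2) f π
    simp only [h2] at this
    rw [this]; congr 1 <;> ring
  rw [← intervalIntegral.integral_add_adjacent_intervals (hi 0 π) (hi π _), e1,
    ← intervalIntegral.integral_add_adjacent_intervals (hi 0 (π/2)) (hi (π/2) _), e2]
  ring

lemma exists_u {p : ℝ} (hp : 1 < p) : ∃ u D : ℝ → ℝ, Continuous D ∧ (∀ x, HasDerivAt u (D x) x) ∧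
    (∀ x, u (x + π) = - u x) ∧ (∀ x, u (π - x) = u x) ∧ (∀ x, D (x + π) = - D x) ∧ (∀ x, D (π - x) = - D x) ∧
    u 0 = 0 ∧ u (π/2) = 1 ∧ ∀ x ∈ Set.Icc 0 (π/2), 0 ≤ u x ∧ u x ≤ 1 ∧
      D x = 2 * II p / π * (1 - (u x)^p)^(1/p) := by
  obtain ⟨S, Sc, Sm, S0, S1, Sd⟩ := exists_S hp
  have hI := II_pos hp
  have hpi := Real.pi_pos
  have hp0 : 0 < 1/p := by positivity
  set β := 2 * II p / π with hβ
  have hβ0 : 0 < β := by positivity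
  have hβ1 : β * (π/2) = II p := by rw [hβ]; field_simp
  set ct : ℝ → ℝ := fun z => β * (1 - (min (S (β * z)) 1)^p)^(1/p) with hct
  have ctc : Continuous ct := by
    have h1 : Continuous fun z => min (S (β * z)) 1 := by fun_prop
    have h2 := (cont_rpow hp).comp h1
    exact continuous_const.mul ((Real.continuous_rpow_const hp0.le).comp (continuous_const.sub h2))
  have ct0 : ∀ z, π/2 ≤ z → ct z = 0 := by
    intro z hz
    have : 1 ≤ S (β * z) := by
      rw [← S1]; apply Sm.monotone; rw [← hβ1]; gcongr
    simp only [hct]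
    rw [min_eq_right this]
    simp [Real.zero_rpow hp0.ne', (by linarith : p ≠ 0)]
  set D : ℝ → ℝ := fun x => ct (arccos (cos x)) - ct (arccos (-cos x)) with hD
  have Dc : Continuous D := by
    have h1 : Continuous fun x => arccos (cos x) := Real.continuous_arccos.comp Real.continuous_cos
    have h2 : Continuous fun x => arccos (-cos x) := Real.continuous_arccos.comp Real.continuous_cos.neg
    exact (ctc.comp h1).sub (ctc.comp h2)
  have D1 : ∀ x, D (x + π) = - D x := by
    intro x; simp only [hD, Real.cos_add_pi, neg_neg]; ring
  have D2 : ∀ x, D (π - x) = - D x := by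
    intro x; simp only [hD, Real.cos_pi_sub, neg_neg]; ring
  have D3 : ∀ x, D (- x) = D x := by
    intro x; simp only [hD, Real.cos_neg]
  have Di : ∀ a b, IntervalIntegrable D volume a b := fun a b => Dc.intervalIntegrable a b
  set u : ℝ → ℝ := fun x => ∫ y in (0:ℝ)..x, D y with hu
  have hupi : u π = 0 := by
    have := intervalIntegral.integral_comp_sub_left (a := 0) (b := π) D π
    simp only [D2, intervalIntegral.integral_neg, sub_self, sub_zero] at this
    simp only [hu]; linarith
  have u1 : ∀ x, u (x + π) = - u x := by
    intro x
    have := intervalIntegral.integral_comp_add_right (a := 0) (b := x) D π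
    simp only [D1, intervalIntegral.integral_neg, zero_add] at this
    have h := intervalIntegral.integral_add_adjacent_intervals (Di 0 π) (Di π (x+π))
    rw [← this] at h
    simp only [hu] at hupi ⊢
    linarith
  have u3 : ∀ x, u (-x) = - u x := by
    intro x
    have := intervalIntegral.integral_comp_neg (a := 0) (b := x) D
    simp only [D3, neg_zero] at this
    simp only [hu]
    rw [this, intervalIntegral.integral_symm]
  have u2 : ∀ x, u (π - x) = u x := by
    intro x
    have := u1 (-x)
    rw [u3, neg_neg] at this
    rw [← this]; congr 1; ring
  have Deq : ∀ x ∈ Set.Icc 0 (π/2), D x = ct x := by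
    intro x hx
    simp only [hD]
    rw [Real.arccos_neg, Real.arccos_cos hx.1 (by linarith [hx.2]), ct0 (π - x) (by linarith [hx.2]), sub_zero]
  have cteq : ∀ x ∈ Set.Icc 0 (π/2), ct x = β * (1 - (S (β * x))^p)^(1/p) := by
    intro x hx
    have : S (β * x) ≤ 1 := by
      rw [← S1]; apply Sm.monotone; rw [← hβ1]; have := hx.2; gcongr
    simp only [hct]
    rw [min_eq_left this]
  have ueq : ∀ x ∈ Set.Icc 0 (π/2), u x = S (β * x) := by
    intro x hx
    have key := intervalIntegral.integral_eq_sub_of_hasDerivAt_of_le hx.1 (f := fun x => S (β * x)) (f' := D)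
      (by fun_prop : Continuous fun x => S (β * x)).continuousOn ?_ (Di 0 x)
    · simp only [hu]; rw [key]; simp [S0]
    · intro y hy
      have hyI : y ∈ Set.Icc 0 (π/2) := ⟨hy.1.le, by linarith [hy.2, hx.2]⟩
      rw [Deq y hyI, cteq y hyI]
      have hd : HasDerivAt (fun y => β * y) β y := by simpa using (hasDerivAt_id y).const_mul β
      have hmem : β * y ∈ Set.Ioo 0 (II p) := by
        refine ⟨mul_pos hβ0 hy.1, ?_⟩
        rw [← hβ1]; apply mul_lt_mul_of_pos_left _ hβ0; linarith [hy.2, hx.2]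
      have := (Sd (β * y) hmem).comp y hd
      rw [mul_comm] at this
      exact this
  refine ⟨u, D, Dc, ?_, u1, u2, D1, D2, by simp [hu], ?_, ?_⟩
  · intro x
    exact intervalIntegral.integral_hasDerivAt_right (Di _ _) Dc.stronglyMeasurable.stronglyMeasurableAtFilter Dc.continuousAt
  · rw [ueq _ ⟨by positivity, le_rfl⟩, hβ1, S1]
  · intro x hx
    rw [Deq x hx, cteq x hx, ueq x hx]
    refine ⟨?_, ?_, rfl⟩
    · rw [← S0]; apply Sm.monotone; have := hx.1; positivity
    · rw [← S1]; apply Sm.monotone; rw [← hβ1]; have := hx.2; gcongr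

lemma extremal {p : ℝ} (hp : 1 < p) : ∃ v : ℝ → ℝ, PeriodicC1 v ∧ v ≠ 0 ∧
    (∫ x in (0:ℝ)..(2 * π), v x) = 0 ∧
    ∫ x in (0:ℝ)..(2*π), |deriv v x|^p = ((p-1) * KK p) * (∫ x in (0:ℝ)..(2*π), |v x|^p) := by
  obtain ⟨u, D, Dc, hd, u1, u2, D1, D2, u0, uh, hq⟩ := exists_u hp
  have hde : deriv u = D := funext fun x => (hd x).deriv
  have uc : Continuous u := continuous_iff_continuousAt.2 fun x => (hd x).continuousAt
  have hpi := Real.pi_pos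
  have hI := II_pos hp
  have hK := KK_pos hp
  refine ⟨u, ⟨?_, ?_⟩, ?_, ?_, ?_⟩
  · intro x
    have : x + 2 * π = (x + π) + π := by ring
    rw [this, u1, u1, neg_neg]
  · rw [contDiff_one_iff_deriv]
    exact ⟨fun x => (hd x).differentiableAt, by rw [hde]; exact Dc⟩
  · intro h
    rw [h] at uh
    simp at uh
  · have e1 : ∫ x in π..(2*π), u x = - ∫ x in (0:ℝ)..π, u x := by
      have := intervalIntegral.integral_comp_add_right (a := 0) (b := π) u π
      simp only [u1, intervalIntegral.integral_neg] at this
      rw [this]; congr 1 <;> ring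
    rw [← intervalIntegral.integral_add_adjacent_intervals (uc.intervalIntegrable 0 π) (uc.intervalIntegrable π _), e1]
    ring
  · rw [hde]
    have c1 : Continuous fun x => |u x|^p := (cont_rpow hp).comp uc.abs
    have c2 : Continuous fun x => |D x|^p := (cont_rpow hp).comp Dc.abs
    have q1 := quarter c1 (fun x => by simp only [u1, abs_neg]) (fun x => by simp only [u2])
    have q2 := quarter c2 (fun x => by simp only [D1, abs_neg]) (fun x => by simp only [D2, abs_neg])
    have hβ0 : 0 < 2 * II p / π := by positivity
    have f1 : ∀ x ∈ Set.Icc 0 (π/2), |D x|^p = KK p * (1 - |u x|^p) := by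
      intro x hx
      obtain ⟨h0, h1, h2⟩ := hq x hx
      have h3 : 0 ≤ 1 - (u x)^p := by linarith [rpow_le_self_of hp ⟨h0, h1⟩]
      rw [h2, abs_of_nonneg h0, abs_of_nonneg (by positivity), Real.mul_rpow hβ0.le (by positivity), ← Real.rpow_mul h3]
      rw [one_div_mul_cancel (by linarith), Real.rpow_one]
      rfl
    have f2 : ∀ x ∈ Set.Icc 0 (π/2), |D x|^p = (KK p)^(1-1/p) * ((1 - (u x)^p)^(1-1/p) * D x) := by
      intro x hx
      obtain ⟨h0, h1, h2⟩ := hq x hx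
      have h3 : 0 ≤ 1 - (u x)^p := by linarith [rpow_le_self_of hp ⟨h0, h1⟩]
      rw [f1 x hx, h2, abs_of_nonneg h0]
      have hsplit : ∀ z : ℝ, 0 ≤ z → z = z^(1-1/p) * z^(1/p) := by
        intro z hz
        rw [← Real.rpow_add_of_nonneg hz (theta_pos hp).le (by positivity)]
        simp
      have hk : (KK p)^(1/p) = 2 * II p / π := by
        unfold KK
        rw [← Real.rpow_mul hβ0.le, mul_one_div_cancel (by linarith), Real.rpow_one]
      rw [← hk]
      calc _ = ((KK p)^(1-1/p) * (KK p)^(1/p)) * ((1 - u x ^ p)^(1-1/p) * (1 - u x ^ p)^(1/p)) := by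
            rw [← hsplit _ hK.le, ← hsplit _ h3]
        _ = _ := by ring
    have g1 : ∫ x in (0:ℝ)..(π/2), |D x|^p = KK p * (π/2 - ∫ x in (0:ℝ)..(π/2), |u x|^p) := by
      rw [intervalIntegral.integral_congr (g := fun x => KK p * (1 - |u x|^p))]
      · rw [intervalIntegral.integral_const_mul, intervalIntegral.integral_sub (by simp) (c1.intervalIntegrable _ _)]
        simp
      · intro x hx
        rw [Set.uIcc_of_le (by positivity)] at hx
        exact f1 x hx
    have g2 : ∫ x in (0:ℝ)..(π/2), |D x|^p = (KK p)^(1-1/p) * JJ p := by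
      rw [intervalIntegral.integral_congr (g := fun x => (KK p)^(1-1/p) * ((1 - (u x)^p)^(1-1/p) * D x))]
      · rw [intervalIntegral.integral_const_mul]
        congr 1
        have := intervalIntegral.integral_comp_mul_deriv (a := 0) (b := π/2) (fun x _ => hd x) Dc.continuousOn (cont_J hp)
        rw [u0, uh] at this
        exact this
      · intro x hx
        rw [Set.uIcc_of_le (by positivity)] at hx
        exact f2 x hx
    rw [q1, q2]
    have rel := KK_rel hp
    set Y := ∫ x in (0:ℝ)..(π/2), |D x|^p
    set Z := ∫ x in (0:ℝ)..(π/2), |u x|^p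
    -- p*Y*2 = π (p-1) K, Y = K(π/2 - Z)
    have r1 : 2 * p * Y = π * ((p-1) * KK p) := by rw [← rel, g2]; ring
    linear_combination (-4 * (p-1)) * g1 + 2 * r1

/-- explicit integral formula for λ₁. -/
theorem lambdaOne_formula (p : ℝ) (hp : 1 < p) :
    lambdaOne p =
      ((2 / π) * ∫ X in (0:ℝ)..1, ((p - 1) / (1 - X ^ p)) ^ (1 / p)) ^ 2 := by
  have hpi := Real.pi_pos
  have hI := II_pos hp
  have hK := KK_pos hp
  have hp1 : 0 < p - 1 := by linarith
  have hβ0 : 0 < 2 * II p / π := by positivity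
  have eI : (2 / π) * ∫ X in (0:ℝ)..1, ((p - 1) / (1 - X ^ p)) ^ (1 / p) = ((p-1) * KK p)^(1/p) := by
    have : ∫ X in (0:ℝ)..1, ((p - 1) / (1 - X ^ p)) ^ (1 / p) = ∫ X in (0:ℝ)..1, (p-1)^(1/p) * (1 - X^p)^(-(1/p)) := by
      apply intervalIntegral.integral_congr
      intro x hx
      rw [Set.uIcc_of_le zero_le_one] at hx
      have h3 : 0 ≤ 1 - x^p := by linarith [rpow_le_self_of hp hx, hx.2]
      simp only []
      rw [Real.div_rpow hp1.le h3, Real.rpow_neg h3]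
      rfl
    rw [this, intervalIntegral.integral_const_mul, Real.mul_rpow hp1.le hK.le]
    have hk : (KK p)^(1/p) = 2 * II p / π := by
      unfold KK
      rw [← Real.rpow_mul hβ0.le, mul_one_div_cancel (by linarith), Real.rpow_one]
    rw [hk]
    unfold II
    ring
  rw [eI]
  have hμ : 0 < (p-1) * KK p := by positivity
  have hp0 : 0 < 1/p := by positivity
  apply IsLeast.csInf_eq
  constructor
  · obtain ⟨v, hv, hne, hmean, he⟩ := extremal hp
    obtain ⟨hZ, _⟩ := lower_bound hp hv hne hmean
    refine ⟨v, hv, hne, hmean, ?_⟩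
    unfold perNorm
    rw [he]
    have : 1 / (2 * π) * ((p - 1) * KK p * ∫ x in (0:ℝ)..(2*π), |v x|^p) = ((p - 1) * KK p) * (1 / (2 * π) * ∫ x in (0:ℝ)..(2*π), |v x|^p) := by ring
    rw [this, Real.mul_rpow hμ.le (by positivity), mul_pow, mul_div_cancel_right₀]
    positivity
  · rintro l ⟨v, hv, hne, hmean, rfl⟩
    obtain ⟨hZ, hle⟩ := lower_bound hp hv hne hmean
    unfold perNorm
    rw [le_div_iff₀ (by positivity), ← mul_pow, ← Real.mul_rpow hμ.le (by positivity)]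
    gcongr ?_ ^ 2
    apply Real.rpow_le_rpow (by positivity) _ hp0.le
    calc _ = 1 / (2 * π) * ((p - 1) * KK p * ∫ x in (0:ℝ)..(2*π), |v x|^p) := by ring
      _ ≤ _ := by gcongr
end

section
/- For every p > 1, λ₁* = A^{(2/p) − 1} · B^{3 − (2/p)}, where A := (2/π) ∫₀^1 ( (2(p−1))/(p(1 − X²)) )^{(1/p) − 1} dX and B := (2/π) ∫₀^1 ( (2(p−1))/(p(1 − X²)) )^{1/p} dX; i.e. the optimal constant λ₁* is given by this explicit integral formula. -/
open MeasureTheory Real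

lemma aux_int {q : ℝ} (h0 : 0 < q) (h1 : q < 1) :
    IntervalIntegrable (fun X : ℝ => (1 - X ^ 2) ^ (-q)) volume 0 1 := by
  have h : IntervalIntegrable (fun X : ℝ => (1 - X) ^ (-q)) volume 0 1 := by
    have := (intervalIntegral.intervalIntegrable_rpow' (a := 0) (b := 1) (r := -q)
      (by linarith)).comp_sub_left 1
    simpa using this.symm
  refine h.mono_fun ?_ ?_
  · apply Measurable.aestronglyMeasurable
    fun_prop
  · rw [Filter.EventuallyLE, ae_restrict_iff' measurableSet_uIoc]
    have : ∀ᵐ x : ℝ, x ≠ 1 := by simp [ae_iff]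
    filter_upwards [this] with x hx1 hx
    rw [Set.uIoc_of_le zero_le_one] at hx
    have hx' : x < 1 := lt_of_le_of_ne hx.2 hx1
    have h3 : 0 < 1 - x := by linarith
    have h4 : 1 - x ≤ 1 - x ^ 2 := by nlinarith [hx.1]
    rw [Real.norm_of_nonneg (rpow_nonneg (by linarith) _),
      Real.norm_of_nonneg (rpow_nonneg (by linarith) _)]
    exact rpow_le_rpow_of_nonpos h3 h4 (by linarith)

lemma aux_IA {q : ℝ} (h0 : 0 < q) (h1 : q < 1) :
    (3 - 2 * q) * ∫ X in (0:ℝ)..1, (1 - X ^ 2) ^ (1 - q)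
      = (2 - 2 * q) * ∫ X in (0:ℝ)..1, (1 - X ^ 2) ^ (-q) := by
  have hi := aux_int h0 h1
  have hc : Continuous (fun X : ℝ => (1 - X ^ 2) ^ (1 - q)) := by
    apply Continuous.rpow_const (by fun_prop)
    intro x; right; linarith
  have hi2 : IntervalIntegrable (fun X : ℝ => (1 - X ^ 2) ^ (1 - q)) volume 0 1 :=
    hc.intervalIntegrable _ _
  have key := intervalIntegral.integral_eq_sub_of_hasDerivAt_of_le (a := 0) (b := 1)
    (f := fun X : ℝ => X * (1 - X ^ 2) ^ (1 - q))
    (f' := fun X : ℝ => (3 - 2 * q) * (1 - X ^ 2) ^ (1 - q) - (2 - 2 * q) * (1 - X ^ 2) ^ (-q))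
    zero_le_one (by fun_prop) (fun x hx => by
      have hpos : 0 < 1 - x ^ 2 := by nlinarith [hx.1, hx.2]
      have hd : HasDerivAt (fun X : ℝ => 1 - X ^ 2) (-(2 * x)) x := by
        simpa using ((hasDerivAt_id x).pow 2).const_sub 1
      have := (hasDerivAt_id x).mul (hd.rpow_const (p := 1 - q) (Or.inl hpos.ne'))
      refine this.congr_deriv ?_
      have e : (1 - x ^ 2) ^ (1 - q) = (1 - x ^ 2) * (1 - x ^ 2) ^ (-q) := by
        rw [← rpow_one_add' hpos.le (by linarith)]; ring_nf
      have e2 : (1 - q - 1) = -q := by ring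
      rw [e2, e]; simp only [id]; ring)
    ((hi2.const_mul _).sub (hi.const_mul _))
  rw [intervalIntegral.integral_sub (hi2.const_mul _) (hi.const_mul _),
    intervalIntegral.integral_const_mul, intervalIntegral.integral_const_mul] at key
  have h2 : (1 - (1:ℝ) ^ 2) ^ (1 - q) = 0 := by
    norm_num; exact zero_rpow (by linarith)
  rw [h2] at key
  linarith

lemma aux_img : Real.sin '' Set.Ioo 0 (π / 2) = Set.Ioo 0 1 := by
  ext y; constructor
  · rintro ⟨x, hx, rfl⟩
    refine ⟨sin_pos_of_pos_of_lt_pi hx.1 (by linarith [hx.2, pi_pos]), ?_⟩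
    have := Real.strictMonoOn_sin (a := x) (b := π/2) ⟨by linarith [hx.1, pi_pos], hx.2.le⟩
      ⟨by linarith [pi_pos], le_refl _⟩ hx.2
    simpa using this
  · intro hy
    refine ⟨arcsin y, ⟨arcsin_pos.2 hy.1, arcsin_lt_pi_div_two.2 hy.2⟩,
      sin_arcsin (by linarith [hy.1]) hy.2.le⟩

noncomputable def gq (q t : ℝ) : ℝ := if cos t = 0 then 1 else |cos t| ^ (1 - 2 * q)

lemma gq_pos (q t : ℝ) : 0 < gq q t := by
  unfold gq; split_ifs with h
  · exact one_pos
  · exact rpow_pos_of_pos (abs_pos.2 h) _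

lemma aux_pt (q : ℝ) {x : ℝ} (hx : x ∈ Set.Ioo 0 (π/2)) :
    |cos x| • (1 - (sin x) ^ 2) ^ (-q) = gq q x := by
  have hc : 0 < cos x := cos_pos_of_mem_Ioo ⟨by linarith [hx.1, pi_pos], hx.2⟩
  rw [gq, if_neg hc.ne', abs_of_pos hc, ← cos_sq', smul_eq_mul, ← rpow_natCast, ← rpow_mul hc.le]
  rw [show (1 - 2 * q) = 1 + ((2:ℕ):ℝ) * (-q) by push_cast; ring, rpow_add hc, rpow_one]

lemma aux_inj : Set.InjOn Real.sin (Set.Ioo 0 (π/2)) :=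
  Real.injOn_sin.mono (fun x (hx : x ∈ Set.Ioo 0 (π/2)) =>
    (⟨by linarith [hx.1, pi_pos], hx.2.le⟩ : x ∈ Set.Icc (-(π/2)) (π/2)))

lemma gq_int0 {q : ℝ} (h0 : 0 < q) (h1 : q < 1) :
    IntervalIntegrable (gq q) volume 0 (π/2) := by
  have hi := aux_int h0 h1
  rw [intervalIntegrable_iff_integrableOn_Ioo_of_le zero_le_one, ← aux_img,
    integrableOn_image_iff_integrableOn_abs_deriv_smul measurableSet_Ioo
      (fun x _ => (hasDerivAt_sin x).hasDerivWithinAt) aux_inj] at hi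
  rw [intervalIntegrable_iff_integrableOn_Ioo_of_le (by positivity)]
  exact hi.congr_fun (fun x hx => aux_pt q hx) measurableSet_Ioo

lemma gq_integral0 {q : ℝ} :
    ∫ t in (0:ℝ)..(π/2), gq q t = ∫ X in (0:ℝ)..1, (1 - X ^ 2) ^ (-q) := by
  rw [intervalIntegral.integral_of_le (by positivity), intervalIntegral.integral_of_le zero_le_one,
    integral_Ioc_eq_integral_Ioo, integral_Ioc_eq_integral_Ioo, ← aux_img,
    integral_image_eq_integral_abs_deriv_smul measurableSet_Ioo
      (fun x _ => (hasDerivAt_sin x).hasDerivWithinAt) aux_inj]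
  exact (setIntegral_congr_fun measurableSet_Ioo (fun x hx => aux_pt q hx)).symm

lemma gq_neg (q t : ℝ) : gq q (-t) = gq q t := by simp [gq]
lemma gq_per (q : ℝ) : Function.Periodic (gq q) π := by intro t; simp [gq]

lemma gq_intneg {q : ℝ} (h0 : 0 < q) (h1 : q < 1) :
    IntervalIntegrable (gq q) volume (-(π/2)) 0 := by
  have := (gq_int0 h0 h1).comp_sub_left 0
  simp only [zero_sub, gq_neg, sub_zero] at this
  exact this.symm

lemma gq_int {q : ℝ} (h0 : 0 < q) (h1 : q < 1) (a b : ℝ) :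
    IntervalIntegrable (gq q) volume a b := by
  refine (gq_per q).intervalIntegrable pi_ne_zero (t := -(π/2)) ?_ a b
  rw [show -(π/2) + π = π/2 by ring]
  exact (gq_intneg h0 h1).trans (gq_int0 h0 h1)

lemma gq_integral {q : ℝ} (h0 : 0 < q) (h1 : q < 1) (x : ℝ) :
    ∫ t in x..(x + π), gq q t = 2 * ∫ X in (0:ℝ)..1, (1 - X ^ 2) ^ (-q) := by
  rw [(gq_per q).intervalIntegral_add_eq x (-(π/2)), show -(π/2) + π = π/2 by ring,
    ← intervalIntegral.integral_add_adjacent_intervals (gq_intneg h0 h1) (gq_int0 h0 h1)]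
  have : ∫ t in (-(π/2))..0, gq q t = ∫ t in (0:ℝ)..(π/2), gq q t := by
    have := intervalIntegral.integral_comp_neg (a := 0) (b := π/2) (gq q)
    simp only [gq_neg, neg_zero] at this
    exact this.symm
  rw [this, gq_integral0]; ring

lemma aux_Kpos {q : ℝ} (h0 : 0 < q) (h1 : q < 1) :
    0 < ∫ X in (0:ℝ)..1, (1 - X ^ 2) ^ (-q) := by
  apply intervalIntegral.intervalIntegral_pos_of_pos_on (aux_int h0 h1) _ one_pos
  intro x hx
  exact rpow_pos_of_pos (by nlinarith [hx.1, hx.2]) _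

lemma gq_contAt (q : ℝ) {t : ℝ} (ht : cos t ≠ 0) : ContinuousAt (gq q) t := by
  have h1 : ContinuousAt (fun t => |cos t| ^ (1 - 2 * q)) t := by
    apply ContinuousAt.rpow_const (by fun_prop)
    left; exact abs_ne_zero.2 ht
  refine h1.congr ?_
  filter_upwards [continuous_cos.continuousAt.eventually_ne ht] with x hx
  simp [gq, hx]

lemma gq_meas (q : ℝ) : Measurable (gq q) := by
  unfold gq
  refine Measurable.ite ?_ (by fun_prop) (by fun_prop)
  exact (isClosed_eq continuous_cos continuous_const).measurableSet

lemma exists_theta {q : ℝ} (h0 : 0 < q) (h1 : q < 1) (κ : ℝ)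
    (hκ : κ = 2 / π * ∫ X in (0:ℝ)..1, (1 - X ^ 2) ^ (-q)) :
    ∃ θ : ℝ → ℝ, Continuous θ ∧ Function.Injective θ ∧ (∀ x, θ (x + 2 * π) = θ x + 2 * π) ∧
      ∀ x, cos (θ x) ≠ 0 → HasDerivAt θ (κ / gq q (θ x)) x := by
  have hK := aux_Kpos h0 h1
  have hκ0 : 0 < κ := by rw [hκ]; positivity
  set Φ : ℝ → ℝ := fun t => (∫ s in (0:ℝ)..t, gq q s) / κ with hΦ
  have hint := gq_int h0 h1
  have hcont : Continuous Φ := (intervalIntegral.continuous_primitive hint 0).div_const _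
  have hmono : StrictMono Φ := by
    intro x y hxy
    have := intervalIntegral.intervalIntegral_pos_of_pos_on (hint x y)
      (fun t _ => gq_pos q t) hxy
    rw [← intervalIntegral.integral_interval_sub_left (hint 0 y) (hint 0 x)] at this
    simp only [hΦ]
    gcongr
    linarith
  have hper : ∀ x, Φ (x + π) = Φ x + π := by
    intro x
    simp only [hΦ]
    rw [← intervalIntegral.integral_add_adjacent_intervals (hint 0 x) (hint x (x + π)),
      gq_integral h0 h1, add_div]
    congr 1
    rw [hκ]; field_simp
  have hper2 : Function.Periodic (fun x => Φ x - x) π := by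
    intro x; simp only [hper]; ring
  have hZ : ∀ n : ℤ, Φ (n * π) = n * π := by
    intro n
    have := hper2.int_mul n 0
    simp [hΦ] at this
    simp only [hΦ]
    linarith
  have hsurj : Function.Surjective Φ := by
    intro y
    apply mem_range_of_exists_le_of_exists_ge hcont
    · refine ⟨(⌊y / π⌋ : ℤ) * π, ?_⟩
      rw [hZ]
      exact (le_div_iff₀ pi_pos).1 (Int.floor_le _)
    · refine ⟨(⌈y / π⌉ : ℤ) * π, ?_⟩
      rw [hZ]
      exact (div_le_iff₀ pi_pos).1 (Int.le_ceil _)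
  set e := StrictMono.orderIsoOfSurjective Φ hmono hsurj with he
  have hΦθ : ∀ x, Φ (e.symm x) = x := fun x => e.apply_symm_apply x
  have hθc : Continuous e.symm := e.symm.continuous
  refine ⟨e.symm, hθc, e.symm.injective, ?_, ?_⟩
  · intro x
    apply hmono.injective
    rw [hΦθ, two_mul, ← add_assoc, ← add_assoc, hper, hper, hΦθ]
  · intro x hx
    have hd : HasDerivAt Φ (gq q (e.symm x) / κ) (e.symm x) := by
      apply HasDerivAt.div_const
      exact intervalIntegral.integral_hasDerivAt_right (hint _ _)
        ((gq_meas q).stronglyMeasurable.stronglyMeasurableAtFilter) (gq_contAt q hx)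
    have := HasDerivAt.of_local_left_inverse hθc.continuousAt hd
      (div_pos (gq_pos q _) hκ0).ne' (Filter.Eventually.of_forall hΦθ)
    rwa [inv_div] at this

lemma cont_sgnpow {b : ℝ} (hb : -1 < b) : Continuous (fun c : ℝ => c * |c| ^ b) := by
  rw [continuous_iff_continuousAt]
  intro c
  rcases eq_or_ne c 0 with rfl | hc
  · have h1 : Filter.Tendsto (fun c : ℝ => |c| ^ (b + 1)) (nhds 0) (nhds 0) := by
      have : Continuous (fun c : ℝ => |c| ^ (b + 1)) :=
        Continuous.rpow_const (by fun_prop) (fun x => Or.inr (by linarith))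
      have := this.tendsto 0
      simpa [zero_rpow (show b + 1 ≠ 0 by linarith)] using this
    rw [ContinuousAt]; simp only [zero_mul]
    rw [tendsto_zero_iff_abs_tendsto_zero]
    refine h1.congr' ?_
    filter_upwards with x
    simp only [Function.comp]
    rw [abs_mul, abs_of_nonneg (rpow_nonneg (abs_nonneg x) b), rpow_add_one' (abs_nonneg x) (by linarith)]
    ring
  · exact continuousAt_id.mul (ContinuousAt.rpow_const (by fun_prop) (Or.inl (abs_ne_zero.2 hc)))

lemma deriv_sgnpow {b c : ℝ} (hc : c ≠ 0) :
    HasDerivAt (fun c : ℝ => c * |c| ^ b) ((1 + b) * |c| ^ b) c := by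
  have := (hasDerivAt_id c).mul ((hasDerivAt_abs hc).rpow_const (p := b) (Or.inl (abs_ne_zero.2 hc)))
  refine this.congr_deriv ?_
  have h2 : (SignType.sign c : ℝ) * c = |c| := sign_mul_self c
  have h3 : |c| ^ b = |c| * |c| ^ (b - 1) := by
    rw [rpow_sub_one (abs_ne_zero.2 hc)]; field_simp
  simp only [id]
  have : c * ((SignType.sign c : ℝ) * b * |c| ^ (b - 1)) = b * |c| ^ b := by
    rw [h3, ← h2]; ring
  rw [this]; ring

lemma exists_extremal {p : ℝ} (hp : 1 < p) (κ : ℝ)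
    (hκ : κ = 2 / π * ∫ X in (0:ℝ)..1, (1 - X ^ 2) ^ (-(1 / p))) :
    ∃ w : ℝ → ℝ, Function.Periodic w (2 * π) ∧ ContDiff ℝ 1 w ∧
      (∫ x in (0:ℝ)..(2 * π), w x) = 0 ∧
      (3 - 2 / p) * (∫ x in (0:ℝ)..(2 * π), |w x| ^ (2:ℝ)) = 2 * π ∧
      (3 - 2 / p) * (∫ x in (0:ℝ)..(2 * π), |deriv w x| ^ p) = κ ^ p * ((2 - 2 / p) * (2 * π)) := by
  have hp0 : 0 < p := by linarith
  have h0 : 0 < 1 / p := by positivity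
  have h1 : 1 / p < 1 := by rw [div_lt_one hp0]; exact hp
  have hκ0 : 0 < κ := by
    have := aux_Kpos h0 h1
    rw [hκ]; positivity
  obtain ⟨θ, hθc, hθi, hθp, hθd⟩ := exists_theta h0 h1 κ hκ
  set q := 1 / p with hq
  have hZ : {t : ℝ | cos t = 0}.Countable := by
    have : {t : ℝ | cos t = 0} = Set.range (fun k : ℤ => (2 * k + 1) * π / 2) := by
      ext t; exact Real.cos_eq_zero_iff.trans ⟨fun ⟨k, hk⟩ => ⟨k, hk.symm⟩, fun ⟨k, hk⟩ => ⟨k, hk.symm⟩⟩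
    rw [this]; exact Set.countable_range _
  have hS : (θ ⁻¹' {t : ℝ | cos t = 0}).Countable := hZ.preimage_of_injOn hθi.injOn
  set h : ℝ → ℝ := fun x => κ * (cos (θ x) * |cos (θ x)| ^ (2 * q - 1)) with hh
  set N : ℝ → ℝ := fun x => cos (θ x) * |cos (θ x)| ^ (1 - 2 * q) with hN
  have hhc : Continuous h :=
    continuous_const.mul ((cont_sgnpow (by linarith)).comp (continuous_cos.comp hθc))
  have hNc : Continuous N := (cont_sgnpow (by linarith)).comp (continuous_cos.comp hθc)
  have hwc : Continuous (fun x => sin (θ x)) := continuous_sin.comp hθc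
  have hg : ∀ x, cos (θ x) ≠ 0 → κ / gq q (θ x) = κ * |cos (θ x)| ^ (2 * q - 1) := by
    intro x hx
    rw [gq, if_neg hx, div_eq_mul_inv, ← rpow_neg (abs_nonneg _)]
    ring_nf
  have hwd0 : ∀ x, cos (θ x) ≠ 0 → HasDerivAt (fun x => sin (θ x)) (h x) x := by
    intro x hx
    refine (hθd x hx).sin.congr_deriv ?_
    rw [hg x hx]; simp only [hh]; ring
  have hNd : ∀ x, cos (θ x) ≠ 0 → HasDerivAt N (-(κ * (2 - 2 * q) * sin (θ x))) x := by
    intro x hx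
    have := (deriv_sgnpow (b := 1 - 2 * q) hx).comp x (hθd x hx).cos
    refine this.congr_deriv ?_
    rw [hg x hx]
    have : |cos (θ x)| ^ (1 - 2 * q) * |cos (θ x)| ^ (2 * q - 1) = 1 := by
      rw [← rpow_add (abs_pos.2 hx)]; simp
    linear_combination (-(κ * (2 - 2 * q) * sin (θ x))) * this
  have hwN : ∀ x, h x * N x = κ * cos (θ x) ^ 2 := by
    intro x
    simp only [hh, hN]
    rcases eq_or_ne (cos (θ x)) 0 with hx | hx
    · simp [hx]
    · have : |cos (θ x)| ^ (1 - 2 * q) * |cos (θ x)| ^ (2 * q - 1) = 1 := by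
        rw [← rpow_add (abs_pos.2 hx)]; simp
      linear_combination (κ * cos (θ x) ^ 2) * this
  have hwint : ∀ x, ∫ s in (0:ℝ)..x, h s = sin (θ x) - sin (θ 0) := by
    intro x
    exact integral_eq_of_hasDerivAt_off_countable (fun x => sin (θ x)) h hS
      hwc.continuousOn (fun y hy => hwd0 y hy.2) (hhc.intervalIntegrable _ _)
  have hwd : ∀ x, HasDerivAt (fun x => sin (θ x)) (h x) x := by
    intro x
    have := intervalIntegral.integral_hasDerivAt_right (hhc.intervalIntegrable 0 x)
      (hhc.stronglyMeasurable.stronglyMeasurableAtFilter) hhc.continuousAt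
    simp only [hwint] at this
    simpa using this.add_const (sin (θ 0))
  have hderiv : deriv (fun x => sin (θ x)) = h := funext fun x => (hwd x).deriv
  have hwper : Function.Periodic (fun x => sin (θ x)) (2 * π) := by
    intro x; simp [hθp]
  have hNper : N (2 * π) = N 0 := by
    have := hθp 0
    rw [zero_add] at this
    simp [hN, this]
  have hw2 : sin (θ (2 * π)) = sin (θ 0) := by
    have := hwper 0
    simpa using this
  have hC : 0 < κ * (2 - 2 * q) := by nlinarith
  have hI1 : ∫ x in (0:ℝ)..(2 * π), sin (θ x) = 0 := by
    have := integral_eq_of_hasDerivAt_off_countable (a := 0) (b := 2 * π) N _ hS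
      hNc.continuousOn (fun y hy => hNd y hy.2) (Continuous.intervalIntegrable (by fun_prop) _ _)
    rw [hNper, sub_self, intervalIntegral.integral_neg, intervalIntegral.integral_const_mul,
      neg_eq_zero] at this
    exact (mul_eq_zero.1 this).resolve_left hC.ne'
  have is2 : IntervalIntegrable (fun x => sin (θ x) ^ 2) volume 0 (2 * π) :=
    Continuous.intervalIntegrable (by fun_prop) _ _
  have ic2 : IntervalIntegrable (fun x => cos (θ x) ^ 2) volume 0 (2 * π) :=
    Continuous.intervalIntegrable (by fun_prop) _ _
  have hsum : (∫ x in (0:ℝ)..(2 * π), sin (θ x) ^ 2) + (∫ x in (0:ℝ)..(2 * π), cos (θ x) ^ 2)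
      = 2 * π := by
    rw [← intervalIntegral.integral_add is2 ic2]
    simp
  have hrel : (∫ x in (0:ℝ)..(2 * π), cos (θ x) ^ 2)
      = (2 - 2 * q) * (∫ x in (0:ℝ)..(2 * π), sin (θ x) ^ 2) := by
    have := integral_eq_of_hasDerivAt_off_countable (a := 0) (b := 2 * π)
      (fun x => sin (θ x) * N x)
      (fun x => κ * cos (θ x) ^ 2 - κ * (2 - 2 * q) * sin (θ x) ^ 2) hS
      (hwc.mul hNc).continuousOn (fun y hy => by
        refine ((hwd y).mul (hNd y hy.2)).congr_deriv ?_
        rw [hwN]; ring) ((ic2.const_mul _).sub (is2.const_mul _))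
    rw [hNper, hw2, sub_self, intervalIntegral.integral_sub (ic2.const_mul _) (is2.const_mul _),
      intervalIntegral.integral_const_mul, intervalIntegral.integral_const_mul] at this
    have h3 : κ * ((∫ x in (0:ℝ)..(2 * π), cos (θ x) ^ 2)
      - (2 - 2 * q) * (∫ x in (0:ℝ)..(2 * π), sin (θ x) ^ 2)) = 0 := by linarith
    have := (mul_eq_zero.1 h3).resolve_left hκ0.ne'
    linarith
  have e2 : 2 / p = 2 * q := by rw [hq]; ring
  rw [e2]
  refine ⟨fun x => sin (θ x), hwper, ?_, hI1, ?_, ?_⟩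
  · rw [contDiff_one_iff_deriv, hderiv]
    exact ⟨fun x => (hwd x).differentiableAt, hhc⟩
  · simp only [rpow_two, sq_abs]
    linarith
  · rw [hderiv]
    have : ∀ x, |h x| ^ p = κ ^ p * cos (θ x) ^ 2 := by
      intro x
      have ha : |h x| = κ * |cos (θ x)| ^ (2 * q) := by
        simp only [hh]
        rw [abs_mul, abs_mul, abs_of_pos hκ0, abs_of_nonneg (rpow_nonneg (abs_nonneg _) (2 * q - 1))]
        have := rpow_one_add' (abs_nonneg (cos (θ x))) (y := 2 * q - 1) (by linarith)
        rw [← this]; ring_nf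
      rw [ha, mul_rpow hκ0.le (rpow_nonneg (abs_nonneg _) _), ← rpow_mul (abs_nonneg _),
        show 2 * q * p = 2 by rw [hq]; field_simp, rpow_two, sq_abs]
    simp only [this]
    rw [intervalIntegral.integral_const_mul]
    have : (3 - 2 * q) * (∫ x in (0:ℝ)..(2 * π), cos (θ x) ^ 2) = (2 - 2 * q) * (2 * π) := by
      linear_combination hrel + (2 - 2 * q) * hsum
    linear_combination κ ^ p * this

lemma lower_holder {p : ℝ} (hp : 1 < p) {z : ℝ → ℝ} (hper : Function.Periodic z (2 * π))
    (hz : ContDiff ℝ 1 z) (hb : ∀ x, |z x| ≤ 1) {x1 x2 : ℝ} (h1 : z x1 = 1) (h2 : z x2 = -1) :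
    4 * (∫ X in (0:ℝ)..1, (1 - X ^ 2) ^ (1 - 1 / p)) ≤
      (∫ x in (0:ℝ)..(2 * π), |deriv z x| ^ p) ^ (1 / p) *
      (∫ x in (0:ℝ)..(2 * π), (1 - z x ^ 2)) ^ (1 - 1 / p) := by
  have hp0 : 0 < p := by linarith
  have hq1 : 1 / p < 1 := by rw [div_lt_one hp0]; exact hp
  obtain ⟨hzd, hzc'⟩ := contDiff_one_iff_deriv.1 hz
  have hzc : Continuous z := hz.continuous
  have hzn : ∀ x, 0 ≤ 1 - z x ^ 2 := fun x => by
    have := abs_le.1 (hb x); nlinarith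
  set φ : ℝ → ℝ := fun X => (1 - X ^ 2) ^ (1 - 1 / p) with hφ
  have hφc : Continuous φ := by
    apply Continuous.rpow_const (by fun_prop)
    intro x; right; linarith
  have hφn : ∀ x, 0 ≤ φ (z x) := fun x => rpow_nonneg (hzn x) _
  set G : ℝ → ℝ := fun y => ∫ X in (0:ℝ)..y, φ X with hG
  have hGd : ∀ y, HasDerivAt G (φ y) y := fun y =>
    intervalIntegral.integral_hasDerivAt_right (hφc.intervalIntegrable _ _)
      (hφc.stronglyMeasurable.stronglyMeasurableAtFilter) hφc.continuousAt
  have hGneg : G (-1) = - G 1 := by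
    have := intervalIntegral.integral_comp_neg (a := 0) (b := 1) φ
    have he : ∀ x, φ (-x) = φ x := fun x => by simp [hφ]
    simp only [he, neg_zero] at this
    simp only [hG]
    rw [this, intervalIntegral.integral_symm]
  have hGz : ∀ x, HasDerivAt (fun x => G (z x)) (φ (z x) * deriv z x) x := fun x =>
    (hGd (z x)).comp x (hzd x).hasDerivAt
  have hc1 : Continuous (fun x => φ (z x) * deriv z x) := (hφc.comp hzc).mul hzc'
  have hc2 : Continuous (fun x => |deriv z x| * φ (z x)) := hzc'.abs.mul (hφc.comp hzc)
  have hftc : ∀ a b, ∫ x in a..b, φ (z x) * deriv z x = G (z b) - G (z a) := fun a b =>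
    intervalIntegral.integral_eq_sub_of_hasDerivAt (fun x _ => hGz x) (hc1.intervalIntegrable _ _)
  have hle : ∀ a b, a ≤ b → |G (z b) - G (z a)| ≤ ∫ x in a..b, |deriv z x| * φ (z x) := by
    intro a b hab
    rw [← hftc]
    refine (intervalIntegral.abs_integral_le_integral_abs hab).trans (le_of_eq ?_)
    congr 1; ext x
    rw [abs_mul, abs_of_nonneg (hφn x), mul_comm]
  have hdper : Function.Periodic (deriv z) (2 * π) := by
    intro x
    have : (fun y => z (y + 2 * π)) = z := funext hper
    rw [← deriv_comp_add_const, this]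
  obtain ⟨y, hy, hzy⟩ := hper.exists_mem_Ico (by positivity) x1 x2
  have hstep : 4 * G 1 ≤ ∫ x in (0:ℝ)..(2 * π), |deriv z x| * φ (z x) := by
    have hpp : Function.Periodic (fun x => |deriv z x| * φ (z x)) (2 * π) := by
      intro x; simp only [hdper x, hper x]
    have e := hpp.intervalIntegral_add_eq 0 x2
    rw [zero_add] at e
    rw [e, ← intervalIntegral.integral_add_adjacent_intervals (hc2.intervalIntegrable x2 y)
      (hc2.intervalIntegrable y _)]
    have a1 := hle x2 y hy.1
    have a2 := hle y (x2 + 2 * π) hy.2.le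
    rw [hper x2] at a2
    rw [← hzy, h1, h2, hGneg] at a1 a2
    have b1 := (le_abs_self _).trans a1
    have b2 := (neg_le_abs _).trans a2
    linarith
  refine hstep.trans ?_
  have hpi : (0:ℝ) ≤ 2 * π := by positivity
  rw [intervalIntegral.integral_of_le hpi, intervalIntegral.integral_of_le hpi,
    intervalIntegral.integral_of_le hpi]
  have hconj : p.HolderConjugate (p / (p - 1)) := Real.HolderConjugate.conjExponent hp
  have hmem : ∀ (f : ℝ → ℝ) (r : ENNReal), Continuous f →
      MemLp f r (volume.restrict (Set.Ioc 0 (2 * π))) := by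
    intro f r hf
    obtain ⟨C, hC⟩ := (isCompact_Icc (a := (0:ℝ)) (b := 2 * π)).exists_bound_of_continuousOn
      hf.continuousOn
    refine MemLp.of_bound hf.aestronglyMeasurable C ?_
    rw [ae_restrict_iff' measurableSet_Ioc]
    exact Filter.Eventually.of_forall fun x hx => hC x ⟨hx.1.le, hx.2⟩
  have := integral_mul_le_Lp_mul_Lq_of_nonneg (μ := volume.restrict (Set.Ioc 0 (2 * π))) hconj
    (f := fun x => |deriv z x|) (g := fun x => φ (z x))
    (Filter.Eventually.of_forall fun x => abs_nonneg _) (Filter.Eventually.of_forall hφn)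
    (hmem _ _ hzc'.abs) (hmem _ _ (hφc.comp hzc))
  refine this.trans (le_of_eq ?_)
  have hp1 : p - 1 ≠ 0 := by linarith
  have e1 : 1 / (p / (p - 1)) = 1 - 1 / p := by field_simp
  have e2 : ∀ x, φ (z x) ^ (p / (p - 1)) = 1 - z x ^ 2 := by
    intro x
    simp only [hφ]
    rw [← rpow_mul (hzn x)]
    have : (1 - 1 / p) * (p / (p - 1)) = 1 := by field_simp
    rw [this, rpow_one]
  simp only [e1, e2]

/-- weighted AM-GM -/
lemma aux_amgm {C s : ℝ} (hC : 0 < C) (h0 : 0 ≤ s) (h1 : s ≤ 1) :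
    s * (1 - s) ^ C * (1 + C) ^ (1 + C) ≤ C ^ C := by
  have h1s : 0 ≤ 1 - s := by linarith
  have hC1 : 0 < 1 + C := by linarith
  have := geom_mean_le_arith_mean2_weighted (w₁ := 1 / (1 + C)) (w₂ := C / (1 + C))
    (p₁ := (1 + C) * s) (p₂ := (1 + C) * (1 - s) / C) (by positivity) (by positivity)
    (by positivity) (by positivity) (by field_simp)
  have e : 1 / (1 + C) * ((1 + C) * s) + C / (1 + C) * ((1 + C) * (1 - s) / C) = 1 := by
    field_simp; ring
  rw [e] at this
  have h3 := rpow_le_rpow (by positivity) this hC1.le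
  rw [one_rpow, mul_rpow (by positivity) (by positivity), ← rpow_mul (by positivity),
    ← rpow_mul (by positivity), one_div_mul_cancel hC1.ne', div_mul_cancel₀ _ hC1.ne', rpow_one,
    div_rpow (by positivity) hC.le, mul_rpow hC1.le h1s, ← mul_div_assoc,
    div_le_one (by positivity)] at h3
  calc _ = (1 + C) * s * ((1 + C) ^ C * (1 - s) ^ C) := by
        rw [rpow_add hC1, rpow_one]; ring
    _ ≤ _ := h3

/-- from Hölder to bound -/
lemma aux_num {q C κ e s : ℝ} (hq0 : 0 < q) (hC : C = 2 - 2 * q) (hC0 : 0 < C) (hκ : 0 < κ)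
    (he : 0 ≤ e) (h0 : 0 ≤ s) (h1 : s ≤ 1)
    (h : κ * C / (1 + C) ≤ e ^ q * (1 - s) ^ (1 - q)) :
    κ ^ 2 * C ^ (2 * q) * (1 + C) ^ (1 - 2 * q) * s ≤ (e ^ q) ^ 2 := by
  have hC1 : 0 < 1 + C := by linarith
  have hs : s < 1 := by
    rcases h1.lt_or_eq with h2 | h2
    · exact h2
    · exfalso
      rw [h2, sub_self, zero_rpow (by linarith), mul_zero] at h
      have : 0 < κ * C / (1 + C) := by positivity
      linarith
  have h1s : 0 < 1 - s := by linarith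
  have hx : 0 < (1 - s) ^ C := rpow_pos_of_pos h1s _
  have hsq := pow_le_pow_left₀ (by positivity) h 2
  have e3 : ((1 - s) ^ (1 - q)) ^ 2 = (1 - s) ^ C := by
    rw [← rpow_natCast, ← rpow_mul h1s.le, hC]; push_cast; ring_nf
  rw [mul_pow, e3] at hsq
  refine le_of_mul_le_mul_right ?_ hx
  refine le_trans ?_ hsq
  have ham := aux_amgm hC0 h0 h1
  have hm : 0 ≤ κ ^ 2 * C ^ (2 * q) * (1 + C) ^ (-2 : ℝ) := by positivity
  have := mul_le_mul_of_nonneg_left ham hm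
  have l1 : (1 + C) ^ (1 - 2 * q) = (1 + C) ^ (-2:ℝ) * (1 + C) ^ (1 + C) := by
    rw [← rpow_add hC1, hC]; ring_nf
  have l2 : C ^ (2 * q) * C ^ C = C ^ 2 := by
    rw [← rpow_add hC0, ← rpow_two]; congr 1; rw [hC]; ring
  have l3 : (1 + C) ^ (-2:ℝ) = ((1 + C) ^ 2)⁻¹ := by
    rw [rpow_neg hC1.le, rpow_two]
  calc _ = κ ^ 2 * C ^ (2 * q) * (1 + C) ^ (-2 : ℝ) * (s * (1 - s) ^ C * (1 + C) ^ (1 + C)) := by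
        rw [l1]; ring
    _ ≤ _ := this
    _ = κ ^ 2 * (C ^ (2 * q) * C ^ C) * (1 + C) ^ (-2 : ℝ) := by ring
    _ = _ := by rw [l2, l3]; field_simp

lemma perNorm_two_sq (v : ℝ → ℝ) :
    perNorm 2 v ^ 2 = (1 / (2 * π)) * ∫ x in (0:ℝ)..(2 * π), |v x| ^ (2:ℝ) := by
  unfold perNorm
  have : 0 ≤ (1 / (2 * π)) * ∫ x in (0:ℝ)..(2 * π), |v x| ^ (2:ℝ) := by
    apply mul_nonneg (by positivity)
    exact intervalIntegral.integral_nonneg (by positivity) (fun x _ => by positivity)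
  rw [← rpow_natCast, ← rpow_mul this]
  norm_num

lemma lower_main {p : ℝ} (hp : 1 < p) (κ C : ℝ)
    (hκ : κ = 2 / π * ∫ X in (0:ℝ)..1, (1 - X ^ 2) ^ (-(1 / p))) (hC : C = 2 - 2 * (1 / p))
    {v : ℝ → ℝ} (hper : Function.Periodic v (2 * π)) (hv : ContDiff ℝ 1 v) (hv0 : v ≠ 0)
    (hm : (∫ x in (0:ℝ)..(2 * π), v x) = 0) :
    κ ^ 2 * C ^ (2 * (1 / p)) * (1 + C) ^ (1 - 2 * (1 / p)) ≤
      (perNorm p (deriv v)) ^ 2 / (perNorm 2 v) ^ 2 := by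
  have hp0 : 0 < p := by linarith
  have h0 : 0 < 1 / p := by positivity
  have h1 : 1 / p < 1 := by rw [div_lt_one hp0]; exact hp
  have hκ0 : 0 < κ := by
    have := aux_Kpos h0 h1
    rw [hκ]; positivity
  have hC0 : 0 < C := by linarith
  have hvc : Continuous v := hv.continuous
  have h2pi : (0:ℝ) < 2 * π := by positivity
  obtain ⟨x1, hx1, hmax⟩ := (isCompact_Icc (a := (0:ℝ)) (b := 2 * π)).exists_isMaxOn
    ⟨0, by simp [h2pi.le]⟩ hvc.continuousOn
  obtain ⟨x2, hx2, hmin⟩ := (isCompact_Icc (a := (0:ℝ)) (b := 2 * π)).exists_isMinOn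
    ⟨0, by simp [h2pi.le]⟩ hvc.continuousOn
  have hmax' : ∀ x, v x ≤ v x1 := by
    intro x
    obtain ⟨y, hy, e⟩ := hper.exists_mem_Ico h2pi x 0
    rw [zero_add] at hy
    rw [e]; exact hmax ⟨hy.1, hy.2.le⟩
  have hmin' : ∀ x, v x2 ≤ v x := by
    intro x
    obtain ⟨y, hy, e⟩ := hper.exists_mem_Ico h2pi x 0
    rw [zero_add] at hy
    rw [e]; exact hmin ⟨hy.1, hy.2.le⟩
  have hlt : v x2 < v x1 := by
    by_contra hcon
    push Not at hcon
    have hconst : ∀ x, v x = v x1 := fun x =>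
      le_antisymm (hmax' x) (hcon.trans (hmin' x))
    have : ∫ x in (0:ℝ)..(2 * π), v x = 2 * π * v x1 := by
      rw [intervalIntegral.integral_congr (g := fun _ => v x1) (fun x _ => hconst x)]
      simp
    rw [this] at hm
    have hz := (mul_eq_zero.1 hm).resolve_left h2pi.ne'
    exact hv0 (funext fun x => by rw [hconst, hz]; rfl)
  set M := (v x1 - v x2) / 2 with hM
  set c := (v x1 + v x2) / 2 with hc
  have hM0 : 0 < M := by rw [hM]; linarith
  set z : ℝ → ℝ := fun x => (v x - c) / M with hz
  have hzper : Function.Periodic z (2 * π) := fun x => by simp only [hz, hper x]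
  have hzC : ContDiff ℝ 1 z := (hv.sub contDiff_const).div_const _
  have hzb : ∀ x, |z x| ≤ 1 := by
    intro x
    simp only [hz]
    rw [abs_div, abs_of_pos hM0, div_le_one hM0, abs_le]
    constructor <;> [have := hmin' x; have := hmax' x] <;> rw [hM, hc] <;> linarith
  have hz1 : z x1 = 1 := by
    simp only [hz]; rw [div_eq_one_iff_eq hM0.ne', hM, hc]; ring
  have hz2 : z x2 = -1 := by
    simp only [hz]; rw [div_eq_iff hM0.ne', hM, hc]; ring
  have hol := lower_holder hp hzper hzC hzb hz1 hz2
  have hdz : ∀ x, deriv v x = M * deriv z x := by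
    intro x
    simp only [hz]
    rw [deriv_div_const, deriv_sub_const]
    field_simp
  set e := (1 / (2 * π)) * ∫ x in (0:ℝ)..(2 * π), |deriv z x| ^ p with he
  set s := (1 / (2 * π)) * ∫ x in (0:ℝ)..(2 * π), z x ^ 2 with hs
  have hE0 : 0 ≤ ∫ x in (0:ℝ)..(2 * π), |deriv z x| ^ p :=
    intervalIntegral.integral_nonneg h2pi.le (fun x _ => by positivity)
  have he0 : 0 ≤ e := by positivity
  have hs0 : 0 ≤ s := mul_nonneg (by positivity)
    (intervalIntegral.integral_nonneg h2pi.le (fun x _ => by positivity))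
  have hzc : Continuous z := hzC.continuous
  have hz2i : IntervalIntegrable (fun x => z x ^ 2) volume 0 (2 * π) :=
    (hzc.pow 2).intervalIntegrable _ _
  have hD : ∫ x in (0:ℝ)..(2 * π), (1 - z x ^ 2) = 2 * π * (1 - s) := by
    rw [intervalIntegral.integral_sub (by simp) hz2i, hs]
    simp
    field_simp
  have hs1 : s ≤ 1 := by
    have : 0 ≤ ∫ x in (0:ℝ)..(2 * π), (1 - z x ^ 2) :=
      intervalIntegral.integral_nonneg h2pi.le (fun x _ => by
        have := abs_le.1 (hzb x); nlinarith)
    rw [hD] at this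
    have := nonneg_of_mul_nonneg_right this h2pi
    linarith
  have hE : ∫ x in (0:ℝ)..(2 * π), |deriv z x| ^ p = 2 * π * e := by
    rw [he]; field_simp
  have hineq : κ * C / (1 + C) ≤ e ^ (1 / p) * (1 - s) ^ (1 - 1 / p) := by
    rw [hD, hE, mul_rpow h2pi.le he0, mul_rpow h2pi.le (by linarith)] at hol
    have e1 : (2 * π) ^ (1 / p) * (2 * π) ^ (1 - 1 / p) = 2 * π := by
      rw [← rpow_add h2pi]; simp
    have hIA := aux_IA h0 h1
    have e4 : κ * C / (1 + C) = 4 * (∫ X in (0:ℝ)..1, (1 - X ^ 2) ^ (1 - 1 / p)) / (2 * π) := by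
      have : (1 + C) = 3 - 2 * (1 / p) := by rw [hC]; ring
      rw [div_eq_div_iff (by linarith) h2pi.ne', this, hκ]
      rw [← hC] at hIA
      have : 2 / π * π = 2 := by field_simp
      linear_combination (-4) * hIA + (2 * C * ∫ X in (0:ℝ)..1, (1 - X ^ 2) ^ (-(1 / p))) * this
    rw [e4, div_le_iff₀ h2pi]
    calc _ ≤ _ := hol
      _ = ((2 * π) ^ (1 / p) * (2 * π) ^ (1 - 1 / p)) * (e ^ (1 / p) * (1 - s) ^ (1 - 1 / p)) := by ring
      _ = _ := by rw [e1]; ring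
  have hnum := aux_num h0 hC hC0 hκ0 he0 hs0 hs1 hineq
  have hN1 : perNorm p (deriv v) ^ 2 = M ^ 2 * (e ^ (1 / p)) ^ 2 := by
    rw [← mul_pow]
    congr 1
    unfold perNorm
    have : ∀ x, |deriv v x| ^ p = M ^ p * |deriv z x| ^ p := by
      intro x
      rw [hdz, abs_mul, abs_of_pos hM0, mul_rpow hM0.le (abs_nonneg _)]
    simp only [this]
    rw [intervalIntegral.integral_const_mul, hE,
      show 1 / (2 * π) * (M ^ p * (2 * π * e)) = M ^ p * e by field_simp,
      mul_rpow (by positivity) he0, ← rpow_mul hM0.le, mul_one_div_cancel hp0.ne', rpow_one]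
  have hvi : IntervalIntegrable v volume 0 (2 * π) := hvc.intervalIntegrable _ _
  have hv2i : IntervalIntegrable (fun x => v x ^ 2) volume 0 (2 * π) :=
    (hvc.pow 2).intervalIntegrable _ _
  have hSv : M ^ 2 * ∫ x in (0:ℝ)..(2 * π), z x ^ 2
      = (∫ x in (0:ℝ)..(2 * π), v x ^ 2) + 2 * π * c ^ 2 := by
    rw [← intervalIntegral.integral_const_mul]
    have : ∀ x, M ^ 2 * z x ^ 2 = v x ^ 2 - 2 * c * v x + c ^ 2 := by
      intro x; simp only [hz]; field_simp; ring
    simp only [this]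
    rw [intervalIntegral.integral_add (hv2i.sub (hvi.const_mul _)) (by simp),
      intervalIntegral.integral_sub hv2i (hvi.const_mul _), intervalIntegral.integral_const_mul, hm]
    simp
  have hN2 : perNorm 2 v ^ 2 ≤ M ^ 2 * s := by
    rw [perNorm_two_sq]
    simp only [rpow_two, sq_abs]
    have : M ^ 2 * s = 1 / (2 * π) * (M ^ 2 * ∫ x in (0:ℝ)..(2 * π), z x ^ 2) := by rw [hs]; ring
    rw [this, hSv]
    have : 0 ≤ 2 * π * c ^ 2 := by positivity
    gcongr
    linarith
  have hN2pos : 0 < perNorm 2 v ^ 2 := by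
    rw [perNorm_two_sq]
    simp only [rpow_two, sq_abs]
    apply mul_pos (by positivity)
    have hx : ∃ x ∈ Set.Icc (0:ℝ) (2 * π), 0 < v x ^ 2 := by
      by_cases h : v x1 = 0
      · exact ⟨x2, hx2, by have : v x2 ≠ 0 := by linarith [h ▸ hlt]
                           positivity⟩
      · exact ⟨x1, hx1, by positivity⟩
    exact intervalIntegral.integral_pos h2pi (hvc.pow 2).continuousOn (fun x _ => by positivity) hx
  rw [le_div_iff₀ hN2pos, hN1]
  have hR : 0 ≤ κ ^ 2 * C ^ (2 * (1 / p)) * (1 + C) ^ (1 - 2 * (1 / p)) := by positivity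
  calc _ ≤ κ ^ 2 * C ^ (2 * (1 / p)) * (1 + C) ^ (1 - 2 * (1 / p)) * (M ^ 2 * s) :=
        mul_le_mul_of_nonneg_left hN2 hR
    _ = M ^ 2 * (κ ^ 2 * C ^ (2 * (1 / p)) * (1 + C) ^ (1 - 2 * (1 / p)) * s) := by ring
    _ ≤ _ := mul_le_mul_of_nonneg_left hnum (by positivity)

/-- explicit integral formula for λ₁*. -/
theorem lambdaOneStar_formula (p : ℝ) (hp : 1 < p)
    (A B : ℝ)
    (hA : A = (2 / π) * ∫ X in (0:ℝ)..1,
      ((2 * (p - 1)) / (p * (1 - X ^ 2))) ^ (1 / p - 1))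
    (hB : B = (2 / π) * ∫ X in (0:ℝ)..1,
      ((2 * (p - 1)) / (p * (1 - X ^ 2))) ^ (1 / p)) :
    lambdaOneStar p = A ^ (2 / p - 1) * B ^ (3 - 2 / p) := by
  have hp0 : 0 < p := by linarith
  have h0 : 0 < 1 / p := by positivity
  have h1 : 1 / p < 1 := by rw [div_lt_one hp0]; exact hp
  have hK := aux_Kpos h0 h1
  obtain ⟨κ, hκ⟩ : ∃ κ, κ = 2 / π * ∫ X in (0:ℝ)..1, (1 - X ^ 2) ^ (-(1 / p)) := ⟨_, rfl⟩
  obtain ⟨C, hC⟩ : ∃ C, C = 2 - 2 * (1 / p) := ⟨_, rfl⟩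
  have hκ0 : 0 < κ := by rw [hκ]; positivity
  have hC0 : 0 < C := by linarith
  have hC1 : 0 < 1 + C := by linarith
  have hbase : ∀ X : ℝ, (2 * (p - 1)) / (p * (1 - X ^ 2)) = C / (1 - X ^ 2) := by
    intro X
    rw [← div_div, hC]; congr 1; field_simp
  have hBv : B = κ * C ^ (1 / p) := by
    rw [hB, hκ]
    have : ∫ X in (0:ℝ)..1, ((2 * (p - 1)) / (p * (1 - X ^ 2))) ^ (1 / p)
        = ∫ X in (0:ℝ)..1, C ^ (1 / p) * (1 - X ^ 2) ^ (-(1 / p)) := by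
      apply intervalIntegral.integral_congr
      intro X hX
      rw [Set.uIcc_of_le zero_le_one] at hX
      have : 0 ≤ 1 - X ^ 2 := by nlinarith [hX.1, hX.2]
      simp only [hbase]
      rw [div_rpow hC0.le this, rpow_neg this, div_eq_mul_inv]
    rw [this, intervalIntegral.integral_const_mul]; ring
  have hAv : A = κ * C ^ (1 / p) / (1 + C) := by
    rw [hA]
    have : ∫ X in (0:ℝ)..1, ((2 * (p - 1)) / (p * (1 - X ^ 2))) ^ (1 / p - 1)
        = ∫ X in (0:ℝ)..1, C ^ (1 / p - 1) * (1 - X ^ 2) ^ (1 - 1 / p) := by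
      apply intervalIntegral.integral_congr
      intro X hX
      rw [Set.uIcc_of_le zero_le_one] at hX
      have : 0 ≤ 1 - X ^ 2 := by nlinarith [hX.1, hX.2]
      simp only [hbase]
      rw [div_rpow hC0.le this, show 1 - 1 / p = -(1 / p - 1) by ring, rpow_neg this,
        div_eq_mul_inv]
    rw [this, intervalIntegral.integral_const_mul, eq_div_iff hC1.ne', hκ]
    have hIA := aux_IA h0 h1
    have e1 : 1 + C = 3 - 2 * (1 / p) := by rw [hC]; ring
    rw [← hC, ← e1] at hIA
    have e2 : C ^ (1 / p) = C ^ (1 / p - 1) * C := by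
      rw [rpow_sub_one hC0.ne']; field_simp
    rw [e2]
    linear_combination (2 / π * C ^ (1 / p - 1)) * hIA
  have hR : A ^ (2 / p - 1) * B ^ (3 - 2 / p)
      = κ ^ 2 * C ^ (2 * (1 / p)) * (1 + C) ^ (1 - 2 * (1 / p)) := by
    have hB0 : 0 < B := by rw [hBv]; positivity
    rw [hAv, ← hBv, div_rpow hB0.le hC1.le, div_mul_eq_mul_div, ← rpow_add hB0,
      show 2 / p - 1 + (3 - 2 / p) = (2:ℝ) by ring, rpow_two, hBv, mul_pow, div_eq_mul_inv,
      ← rpow_neg hC1.le, ← rpow_natCast (C ^ (1 / p)), ← rpow_mul hC0.le]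
    push_cast
    ring_nf
  rw [hR]
  apply IsLeast.csInf_eq
  constructor
  · obtain ⟨w, hwp, hwC, hw0, hw2, hwd⟩ := exists_extremal hp κ hκ
    have e1 : 3 - 2 / p = 1 + C := by rw [hC]; ring
    have e2 : 2 - 2 / p = C := by rw [hC]; ring
    rw [e1] at hw2 hwd
    rw [e2] at hwd
    refine ⟨w, ⟨hwp, hwC⟩, ?_, hw0, ?_⟩
    · rintro rfl
      have h2 : (0:ℝ) < 2 * π := by positivity
      rw [← hw2] at h2
      simp [zero_rpow] at h2
    · have f2 : perNorm 2 w ^ 2 = 1 / (1 + C) := by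
        rw [perNorm_two_sq, div_mul_eq_mul_div, div_eq_div_iff (by positivity) hC1.ne']
        linarith
      have f1 : perNorm p (deriv w) ^ 2 = κ ^ 2 * (C / (1 + C)) ^ (2 * (1 / p)) := by
        have g1 : (1 / (2 * π)) * ∫ x in (0:ℝ)..(2 * π), |deriv w x| ^ p
            = κ ^ p * (C / (1 + C)) := by
          rw [div_mul_eq_mul_div, ← mul_div_assoc, div_eq_div_iff (by positivity) hC1.ne']
          linarith
        unfold perNorm
        rw [g1, mul_rpow (by positivity) (by positivity), ← rpow_mul hκ0.le,
          mul_one_div_cancel hp0.ne', rpow_one, mul_pow, ← rpow_natCast ((C / (1 + C)) ^ (1 / p)),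
          ← rpow_mul (by positivity)]
        push_cast
        ring_nf
      rw [f1, f2, div_rpow hC0.le hC1.le, rpow_sub hC1, rpow_one]
      field_simp
  · rintro l ⟨v, ⟨hvp, hvC⟩, hv0, hvm, rfl⟩
    exact lower_main hp κ C hκ hC hvp hvC hv0 hvm
end
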